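/- arXiv:1011.4671 — 4 statements merged into one kernel-verified Lean document; each statement's English description precedes it below -/
import Mathlib

section
/- The diagonal 2-dimensional rook walk numbers a(n,n) satisfy, for every n ≥ 0, the recurrence (n+2)·a(n+2,n+2) − (10n+14)·a(n+1,n+1) + 9n·a(n,n) = 0. -/
/-- The set of `d`-dimensional rook walks from the origin to `v`: a walk is a
finite sequence of steps, each step adding a positive integer amount to
exactly one coordinate (a step is recorded as a pair of the chosen coordinate
and the positive amount added). -/
def RookWalks (d : ℕ) (v : Fin d → ℕ) : Set (List (Fin d × ℕ)) :=
  {L | (∀ s ∈ L, 0 < s.2) ∧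
       ∀ i : Fin d, (L.map (fun s => if s.1 = i then s.2 else 0)).sum = v i}

/-- The number of `d`-dimensional rook walks from the origin to `v`. -/
noncomputable def rookWalkCount (d : ℕ) (v : Fin d → ℕ) : ℕ :=
  (RookWalks d v).ncard

/-- The rook walks to `v` whose first step changes coordinate `i`. -/
def RookWalksFrom {d : ℕ} (i : Fin d) (v : Fin d → ℕ) : Set (List (Fin d × ℕ)) :=
  {L | L ∈ RookWalks d v ∧ ∃ k T, L = (i, k) :: T}

/-- Increase the length of the first step of a walk by one. -/
def lengthenFirst {d : ℕ} : List (Fin d × ℕ) → List (Fin d × ℕ)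
  | [] => []
  | (i, k) :: T => (i, k + 1) :: T

theorem lengthenFirst_injective {d : ℕ} :
    Function.Injective (lengthenFirst (d := d)) := by
  rintro (_ | ⟨⟨i, k⟩, S⟩) (_ | ⟨⟨j, l⟩, T⟩) h <;> simp_all [lengthenFirst]

theorem cons_mem_rookWalks {d : ℕ} (i : Fin d) (k : ℕ) (T : List (Fin d × ℕ)) (v : Fin d → ℕ) :
    (i, k) :: T ∈ RookWalks d v ↔ 0 < k ∧ (∀ s ∈ T, 0 < s.2) ∧
      ∀ j, (if i = j then k else 0) +
        (T.map (fun s => if s.1 = j then s.2 else 0)).sum = v j := by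
  simp only [RookWalks, Set.mem_ofPred_eq, List.forall_mem_cons, List.map_cons, List.sum_cons,
    and_assoc]

theorem rookWalksFrom_add_single {d : ℕ} (i : Fin d) (v : Fin d → ℕ) :
    RookWalksFrom i (v + Pi.single i 1) =
      Set.image (List.cons (i, 1)) (RookWalks d v) ∪ Set.image lengthenFirst (RookWalksFrom i v) := by
  ext L
  constructor
  · rintro ⟨hL, k, T, rfl⟩
    rw [cons_mem_rookWalks] at hL
    obtain ⟨hk, hT, hsum⟩ := hL
    obtain _ | _ | k := k
    · omega
    · refine Or.inl ⟨T, ⟨hT, fun j => ?_⟩, rfl⟩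
      have := hsum j
      simp only [Pi.add_apply, Pi.single_apply] at this
      grind
    · refine Or.inr ⟨(i, k + 1) :: T, ⟨?_, _, _, rfl⟩, rfl⟩
      rw [cons_mem_rookWalks]
      refine ⟨by omega, hT, fun j => ?_⟩
      have := hsum j
      simp only [Pi.add_apply, Pi.single_apply] at this
      grind
  · rintro (⟨T, ⟨hT, hsum⟩, rfl⟩ | ⟨_, ⟨hL, k, T, rfl⟩, rfl⟩)
    · refine ⟨?_, _, _, rfl⟩
      rw [cons_mem_rookWalks]
      refine ⟨by omega, hT, fun j => ?_⟩
      have := hsum j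
      simp only [Pi.add_apply, Pi.single_apply]
      grind
    · refine ⟨?_, _, _, rfl⟩
      rw [lengthenFirst, cons_mem_rookWalks]
      rw [cons_mem_rookWalks] at hL
      obtain ⟨hk, hT, hsum⟩ := hL
      refine ⟨by omega, hT, fun j => ?_⟩
      have := hsum j
      simp only [Pi.add_apply, Pi.single_apply]
      grind

theorem rookWalksFrom_eq_empty {d : ℕ} {i : Fin d} {v : Fin d → ℕ} (h : v i = 0) :
    RookWalksFrom i v = ∅ := by
  rw [Set.eq_empty_iff_forall_notMem]
  rintro _ ⟨hL, k, T, rfl⟩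
  rw [cons_mem_rookWalks] at hL
  have := hL.2.2 i
  simp only [if_true] at this
  omega

theorem rookWalks_eq_union {d : ℕ} (v : Fin d → ℕ) :
    RookWalks d v = {L | L = [] ∧ v = 0} ∪ ⋃ i, RookWalksFrom i v := by
  ext L
  rcases L with _ | ⟨⟨i, k⟩, T⟩
  · simp [RookWalks, RookWalksFrom, funext_iff, @eq_comm ℕ 0]
  · simp [RookWalksFrom]

theorem rookWalks_finite {d : ℕ} (v : Fin d → ℕ) : (RookWalks d v).Finite := by
  induction h : ∑ i, v i using Nat.strong_induction_on generalizing v with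
  | _ N ih =>
    rw [rookWalks_eq_union]
    refine Set.Finite.union ((Set.finite_singleton []).subset fun L hL => hL.1)
      (Set.finite_iUnion fun i => ?_)
    by_cases hi : v i = 0
    · simp [rookWalksFrom_eq_empty hi]
    · obtain ⟨w, rfl⟩ : ∃ w : Fin d → ℕ, v = w + Pi.single i 1 := by
        refine ⟨v - Pi.single i 1, ?_⟩
        ext j
        simp only [Pi.add_apply, Pi.sub_apply, Pi.single_apply]
        grind
      have hw : (RookWalks d w).Finite := by
        refine ih _ ?_ w rfl
        rw [← h]
        simp [Finset.sum_add_distrib]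
      rw [rookWalksFrom_add_single]
      exact (hw.image _).union ((hw.subset fun L hL => hL.1).image _)

theorem rookWalksFrom_finite {d : ℕ} (i : Fin d) (v : Fin d → ℕ) : (RookWalksFrom i v).Finite :=
  (rookWalks_finite v).subset fun _ hL => hL.1

theorem ncard_rookWalksFrom_add_single {d : ℕ} (i : Fin d) (v : Fin d → ℕ) :
    (RookWalksFrom i (v + Pi.single i 1)).ncard =
      rookWalkCount d v + (RookWalksFrom i v).ncard := by
  rw [rookWalksFrom_add_single, Set.ncard_union_eq ?_ ((rookWalks_finite v).image _)
    ((rookWalksFrom_finite i v).image _), Set.ncard_image_of_injective _ List.cons_injective,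
    Set.ncard_image_of_injective _ lengthenFirst_injective, rookWalkCount]
  rw [Set.disjoint_left]
  rintro _ ⟨S, -, rfl⟩ ⟨_, ⟨hL, k, T, rfl⟩, h⟩
  rw [cons_mem_rookWalks] at hL
  simp [lengthenFirst] at h
  omega

theorem rookWalkCount_two_zero : rookWalkCount 2 ![0, 0] = 1 := by
  have : RookWalks 2 ![0, 0] = {[]} := by
    rw [rookWalks_eq_union]
    ext L
    simp only [Set.mem_union, Set.mem_iUnion, Fin.exists_fin_two]
    rw [rookWalksFrom_eq_empty (i := 0) (by simp), rookWalksFrom_eq_empty (i := 1) (by simp)]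
    simp
  rw [rookWalkCount, this, Set.ncard_singleton]

theorem rookWalkCount_two_eq_add {v : Fin 2 → ℕ} (hv : v ≠ 0) :
    rookWalkCount 2 v = (RookWalksFrom 0 v).ncard + (RookWalksFrom 1 v).ncard := by
  have : RookWalks 2 v = RookWalksFrom 0 v ∪ RookWalksFrom 1 v := by
    rw [rookWalks_eq_union]
    ext L
    simp [hv, Fin.exists_fin_two]
  rw [rookWalkCount, this, Set.ncard_union_eq ?_ (rookWalksFrom_finite _ _)
    (rookWalksFrom_finite _ _)]
  rw [Set.disjoint_left]
  rintro _ ⟨-, k, T, rfl⟩ ⟨-, l, S, h⟩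
  simp at h

theorem ncard_rookWalksFrom_zero_succ (n m : ℕ) :
    (RookWalksFrom 0 ![n + 1, m]).ncard =
      rookWalkCount 2 ![n, m] + (RookWalksFrom 0 ![n, m]).ncard := by
  rw [← ncard_rookWalksFrom_add_single]
  congr 2
  ext j
  fin_cases j <;> simp

theorem ncard_rookWalksFrom_one_succ (n m : ℕ) :
    (RookWalksFrom 1 ![n, m + 1]).ncard =
      rookWalkCount 2 ![n, m] + (RookWalksFrom 1 ![n, m]).ncard := by
  rw [← ncard_rookWalksFrom_add_single]
  congr 2
  ext j
  fin_cases j <;> simp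

theorem rookWalkCount_two_succ_zero (n : ℕ) : rookWalkCount 2 ![n + 1, 0] = 2 ^ n := by
  have hy (k : ℕ) : (RookWalksFrom 1 ![k, 0]).ncard = 0 := by
    rw [rookWalksFrom_eq_empty (by simp), Set.ncard_empty]
  have hx (k : ℕ) : rookWalkCount 2 ![k + 1, 0] = (RookWalksFrom 0 ![k + 1, 0]).ncard := by
    rw [rookWalkCount_two_eq_add (by simp), hy, add_zero]
  induction n with
  | zero =>
    rw [hx, ncard_rookWalksFrom_zero_succ, rookWalkCount_two_zero,
      rookWalksFrom_eq_empty (by simp), Set.ncard_empty, pow_zero, add_zero]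
  | succ n ih => rw [hx, ncard_rookWalksFrom_zero_succ, ← hx, ih, pow_succ, mul_two]

theorem rookWalkCount_two_zero_succ (m : ℕ) : rookWalkCount 2 ![0, m + 1] = 2 ^ m := by
  have hx (k : ℕ) : (RookWalksFrom 0 ![0, k]).ncard = 0 := by
    rw [rookWalksFrom_eq_empty (by simp), Set.ncard_empty]
  have hy (k : ℕ) : rookWalkCount 2 ![0, k + 1] = (RookWalksFrom 1 ![0, k + 1]).ncard := by
    rw [rookWalkCount_two_eq_add (by simp), hx, zero_add]
  induction m with
  | zero =>
    rw [hy, ncard_rookWalksFrom_one_succ, rookWalkCount_two_zero,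
      rookWalksFrom_eq_empty (by simp), Set.ncard_empty, pow_zero, add_zero]
  | succ m ih => rw [hy, ncard_rookWalksFrom_one_succ, ← hy, ih, pow_succ, mul_two]

theorem rookWalkCount_two_one_one : rookWalkCount 2 ![1, 1] = 2 := by
  rw [rookWalkCount_two_eq_add (by simp), ncard_rookWalksFrom_zero_succ 0 1,
    ncard_rookWalksFrom_one_succ 1 0, rookWalkCount_two_succ_zero, rookWalkCount_two_zero_succ,
    rookWalksFrom_eq_empty (by simp), rookWalksFrom_eq_empty (by simp)]
  simp

theorem rookWalkCount_two_succ_succ {n m : ℕ} (h : n ≠ 0 ∨ m ≠ 0) :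
    (rookWalkCount 2 ![n + 1, m + 1] : ℤ) = 2 * rookWalkCount 2 ![n, m + 1] +
      2 * rookWalkCount 2 ![n + 1, m] - 3 * rookWalkCount 2 ![n, m] := by
  have h₀ : rookWalkCount 2 ![n, m] = _ := rookWalkCount_two_eq_add (by simp; tauto)
  have h₁ : rookWalkCount 2 ![n + 1, m] = _ := rookWalkCount_two_eq_add (by simp)
  have h₂ : rookWalkCount 2 ![n, m + 1] = _ := rookWalkCount_two_eq_add (by simp)
  have h₃ : rookWalkCount 2 ![n + 1, m + 1] = _ := rookWalkCount_two_eq_add (by simp)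
  have := ncard_rookWalksFrom_zero_succ n m
  have := ncard_rookWalksFrom_zero_succ n (m + 1)
  have := ncard_rookWalksFrom_one_succ n m
  have := ncard_rookWalksFrom_one_succ (n + 1) m
  omega

/-- The coefficient of `x ^ n * y ^ m` in `1 / (1 - 2 * x - 2 * y + 3 * x * y)`. -/
def invCoeff : ℕ → ℕ → ℤ
  | 0, m => 2 ^ m
  | n + 1, 0 => 2 ^ (n + 1)
  | n + 1, m + 1 => 2 * invCoeff n (m + 1) + 2 * invCoeff (n + 1) m - 3 * invCoeff n m

theorem invCoeff_zero_right (n : ℕ) : invCoeff n 0 = 2 ^ n := by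
  cases n <;> simp [invCoeff]

theorem invCoeff_comm (n m : ℕ) : invCoeff n m = invCoeff m n := by
  induction n generalizing m with
  | zero => rw [invCoeff_zero_right, invCoeff]
  | succ n ihn =>
    induction m with
    | zero => rw [invCoeff_zero_right, invCoeff]
    | succ m ihm => rw [invCoeff, invCoeff, ihn, ihm, ihn]; ring

/-- Coefficient form of `(2 - 3 * x) * ∂F/∂x = (2 - 3 * y) * ∂F/∂y` for
`F = 1 / (1 - 2 * x - 2 * y + 3 * x * y)`. -/
theorem invCoeff_exchange (n m : ℕ) :
    2 * (n + 1) * invCoeff (n + 1) m - 2 * (m + 1) * invCoeff n (m + 1) =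
      3 * (n - m) * invCoeff n m := by
  have hzero (k : ℕ) :
      2 * (k + 1) * invCoeff (k + 1) 0 - 2 * invCoeff k 1 = 3 * k * invCoeff k 0 := by
    induction k with
    | zero => simp [invCoeff]
    | succ k ih =>
      have h₁ : invCoeff (k + 1) 1 = _ := invCoeff.eq_3 k 0
      rw [h₁]
      simp only [zero_add, invCoeff_zero_right, pow_succ] at ih ⊢
      push_cast
      linear_combination 2 * ih
  induction n generalizing m with
  | zero =>
    have := hzero m
    rw [invCoeff_comm _ 0, invCoeff_comm _ 0, invCoeff_comm _ 1] at this
    push_cast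
    linear_combination -this
  | succ n ihn =>
    induction m with
    | zero =>
      have := hzero (n + 1)
      push_cast at this ⊢
      linear_combination this
    | succ m ihm =>
      have h₁ := ihn m
      have h₂ := ihn (m + 1)
      have r₀ := invCoeff.eq_3 n m
      have r₁ := invCoeff.eq_3 (n + 1) m
      have r₂ := invCoeff.eq_3 n (m + 1)
      push_cast at *
      linear_combination 2 * h₂ + 2 * ihm - 3 * h₁ + 2 * (n + 2) * r₁ - 2 * (m + 2) * r₂ -
        3 * (n - m) * r₀

theorem invCoeff_diag_recurrence (n : ℕ) :
    (n + 2) * invCoeff (n + 2) (n + 2) =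
      5 * (2 * n + 3) * invCoeff (n + 1) (n + 1) - 9 * (n + 1) * invCoeff n n := by
  have hD := invCoeff_exchange (n + 1) n
  have h₁ : invCoeff (n + 1) (n + 1) = _ := invCoeff.eq_3 n n
  have h₂ : invCoeff (n + 2) (n + 2) = _ := invCoeff.eq_3 (n + 1) (n + 1)
  have h₃ : invCoeff (n + 2) (n + 1) = _ := invCoeff.eq_3 (n + 1) n
  rw [invCoeff_comm n (n + 1)] at h₁
  rw [invCoeff_comm (n + 1) (n + 1 + 1)] at h₂
  push_cast at hD
  simp only [add_assoc, Nat.reduceAdd] at *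
  grind

theorem rookWalkCount_two_eq_invCoeff (n m : ℕ) :
    (rookWalkCount 2 ![n + 1, m + 1] : ℤ) =
      invCoeff (n + 1) (m + 1) - invCoeff n (m + 1) - invCoeff (n + 1) m + invCoeff n m := by
  induction n generalizing m with
  | zero =>
    induction m with
    | zero => simp [rookWalkCount_two_one_one, invCoeff]
    | succ m ihm =>
      rw [rookWalkCount_two_succ_succ (by simp), ihm, rookWalkCount_two_zero_succ,
        rookWalkCount_two_zero_succ]
      simp only [invCoeff]
      push_cast
      ring
  | succ n ihn =>
    induction m with
    | zero =>
      rw [rookWalkCount_two_succ_succ (by simp), ihn, rookWalkCount_two_succ_zero,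
        rookWalkCount_two_succ_zero]
      simp only [invCoeff, invCoeff_zero_right]
      push_cast
      ring
    | succ m ihm =>
      rw [rookWalkCount_two_succ_succ (by simp), ihn, ihm, ihn]
      simp only [invCoeff]
      ring

theorem two_mul_rookWalkCount_diag (n : ℕ) :
    2 * (rookWalkCount 2 ![n + 1, n + 1] : ℤ) = invCoeff (n + 1) (n + 1) - invCoeff n n := by
  rw [rookWalkCount_two_eq_invCoeff, invCoeff.eq_3, invCoeff_comm n (n + 1)]
  ring

/-- The diagonal 2-dimensional rook walk numbers `a(n,n)` satisfy
`(n+2)·a(n+2,n+2) − (10n+14)·a(n+1,n+1) + 9n·a(n,n) = 0` for all `n ≥ 0`. -/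
theorem rook_diag_recurrence_two_dim (n : ℕ) :
    ((n : ℤ) + 2) * (rookWalkCount 2 (fun _ => n + 2) : ℤ)
      - (10 * (n : ℤ) + 14) * (rookWalkCount 2 (fun _ => n + 1) : ℤ)
      + 9 * (n : ℤ) * (rookWalkCount 2 (fun _ => n) : ℤ) = 0 := by
  have hconst (k : ℕ) : (fun _ => k : Fin 2 → ℕ) = ![k, k] := by
    ext j
    fin_cases j <;> rfl
  simp only [hconst]
  have h₁ := two_mul_rookWalkCount_diag n
  have h₂ := two_mul_rookWalkCount_diag (n + 1)
  have hc := invCoeff_diag_recurrence n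
  obtain _ | n := n
  · simp [invCoeff] at h₁ h₂ ⊢
    linarith
  · have h₀ := two_mul_rookWalkCount_diag n
    have hc' := invCoeff_diag_recurrence n
    push_cast at *
    simp only [add_assoc, Nat.reduceAdd] at *
    grind
end

section
/- The diagonal 2-dimensional rook walk numbers satisfy a(n,n) ~ √(2/(πn)) · 3^{2n−1} as n → ∞; that is, the quotient a(n,n) / (√(2/(πn)) · 3^{2n−1}) tends to 1 as n → ∞. -/
open Filter Real

open Finset in
/-- A walk to a nonzero vector in the plane splits uniquely into its first step and a walk to an
earlier vector. -/
theorem mem_rookWalks_two_iff {n m : ℕ} (h : ¬(n = 0 ∧ m = 0)) (L : List (Fin 2 × ℕ)) :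
    L ∈ RookWalks 2 ![n, m] ↔
      (∃ i ∈ range n, ∃ L' ∈ RookWalks 2 ![i, m], (0, n - i) :: L' = L) ∨
      (∃ j ∈ range m, ∃ L' ∈ RookWalks 2 ![n, j], (1, m - j) :: L' = L) := by
  constructor
  · rintro ⟨hpos, hsum⟩
    rw [Fin.forall_fin_two] at hsum
    obtain ⟨h0, h1⟩ := hsum
    match L with
    | [] => exact absurd ⟨by simpa using h0.symm, by simpa using h1.symm⟩ h
    | (c, k) :: L' =>
      have hk : 0 < k := hpos (c, k) (by simp)
      have hL' : ∀ s ∈ L', 0 < s.2 := fun s hs => hpos s (by simp [hs])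
      fin_cases c
      · left
        simp only [List.map_cons, List.sum_cons] at h0 h1
        simp at h0 h1
        refine ⟨n - k, by simp; omega, L', ⟨hL', ?_⟩, ?_⟩
        · rw [Fin.forall_fin_two]
          refine ⟨?_, ?_⟩ <;> simp <;> omega
        · have : n - (n - k) = k := by omega
          simp [this]
      · right
        simp only [List.map_cons, List.sum_cons] at h0 h1
        simp at h0 h1
        refine ⟨m - k, by simp; omega, L', ⟨hL', ?_⟩, ?_⟩
        · rw [Fin.forall_fin_two]
          refine ⟨?_, ?_⟩ <;> simp <;> omega
        · have : m - (m - k) = k := by omega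
          simp [this]
  · rintro (⟨i, hi, L', ⟨hpos, hsum⟩, rfl⟩ | ⟨i, hi, L', ⟨hpos, hsum⟩, rfl⟩) <;>
    · rw [mem_range] at hi
      rw [Fin.forall_fin_two] at hsum
      simp at hsum
      refine ⟨?_, ?_⟩
      · simp only [List.mem_cons, forall_eq_or_imp]
        exact ⟨by simp; omega, hpos⟩
      · rw [Fin.forall_fin_two]
        simp
        omega

open Finset in
/-- The recurrence over the first step determines the planar rook walk numbers, in any semiring. -/
theorem rookWalkCount_two_eq_of_recurrence {R : Type*} [Semiring R] (f : ℕ → ℕ → R)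
    (f_zero : f 0 0 = 1)
    (f_rec : ∀ n m, ¬(n = 0 ∧ m = 0) →
      f n m = ∑ i ∈ range n, f i m + ∑ j ∈ range m, f n j) (n m : ℕ) :
    (rookWalkCount 2 ![n, m] : R) = f n m := by
  classical
  suffices H : ∀ s n m, n + m = s → ∃ S : Finset (List (Fin 2 × ℕ)),
      (S : Set (List (Fin 2 × ℕ))) = RookWalks 2 ![n, m] ∧ (S.card : R) = f n m by
    obtain ⟨S, hS, hc⟩ := H _ n m rfl
    rw [rookWalkCount, ← hS, Set.ncard_coe_finset, hc]
  intro s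
  induction s using Nat.strong_induction_on with
  | _ s ih =>
  intro n m hs
  by_cases h : n = 0 ∧ m = 0
  · obtain ⟨rfl, rfl⟩ := h
    refine ⟨{[]}, ?_, by simp [f_zero]⟩
    ext L
    simp only [coe_singleton, Set.mem_singleton_iff]
    constructor
    · rintro rfl
      simp [RookWalks, Fin.forall_fin_two]
    · rintro ⟨hpos, hsum⟩
      match L with
      | [] => rfl
      | (c, k) :: L' =>
        have hk : 0 < k := hpos (c, k) (by simp)
        have := hsum c
        fin_cases c <;> simp at this <;> omega
  · have hA : ∀ i : ℕ, ∃ S : Finset (List (Fin 2 × ℕ)), i < n →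
        (S : Set (List (Fin 2 × ℕ))) = RookWalks 2 ![i, m] ∧ (S.card : R) = f i m := by
      intro i
      by_cases hi : i < n
      · obtain ⟨S, hS⟩ := ih (i + m) (by omega) i m rfl
        exact ⟨S, fun _ => hS⟩
      · exact ⟨∅, fun h => absurd h hi⟩
    have hB : ∀ j : ℕ, ∃ S : Finset (List (Fin 2 × ℕ)), j < m →
        (S : Set (List (Fin 2 × ℕ))) = RookWalks 2 ![n, j] ∧ (S.card : R) = f n j := by
      intro j
      by_cases hj : j < m
      · obtain ⟨S, hS⟩ := ih (n + j) (by omega) n j rfl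
        exact ⟨S, fun _ => hS⟩
      · exact ⟨∅, fun h => absurd h hj⟩
    choose A hA using hA
    choose B hB using hB
    refine ⟨(range n).biUnion (fun i => (A i).image ((0, n - i) :: ·)) ∪
      (range m).biUnion (fun j => (B j).image ((1, m - j) :: ·)), ?_, ?_⟩
    · ext L
      rw [mem_rookWalks_two_iff h, mem_coe, mem_union, mem_biUnion, mem_biUnion]
      refine or_congr ?_ ?_
      · refine exists_congr fun i => and_congr_right fun hi => ?_
        rw [← (hA i (mem_range.1 hi)).1]
        simp
      · refine exists_congr fun j => and_congr_right fun hj => ?_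
        rw [← (hB j (mem_range.1 hj)).1]
        simp
    · rw [card_union_of_disjoint, card_biUnion, card_biUnion, f_rec n m h]
      · push_cast
        refine congr_arg₂ _ (sum_congr rfl fun i hi => ?_) (sum_congr rfl fun j hj => ?_)
        · rw [card_image_of_injective _ (List.cons_injective), (hA i (mem_range.1 hi)).2]
        · rw [card_image_of_injective _ (List.cons_injective), (hB j (mem_range.1 hj)).2]
      · intro i hi j hj hij
        rw [mem_coe, mem_range] at hi hj
        simp only [Function.onFun, disjoint_left, mem_image]
        rintro _ ⟨L, -, rfl⟩ ⟨L', -, hcons⟩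
        simp at hcons
        omega
      · intro i hi j hj hij
        rw [mem_coe, mem_range] at hi hj
        simp only [Function.onFun, disjoint_left, mem_image]
        rintro _ ⟨L, -, rfl⟩ ⟨L', -, hcons⟩
        simp at hcons
        omega
      · simp only [disjoint_left, mem_biUnion, mem_image]
        rintro _ ⟨i, -, L, -, rfl⟩ ⟨j, -, L', -, hcons⟩
        simp at hcons

/-- The polynomials `1, (2 + z)^n (1 + z)` whose products, averaged over the unit circle, give the
planar rook walk numbers. -/
noncomputable def rookPoly : ℕ → ℂ → ℂ
  | 0, _ => 1
  | n + 1, z => (2 + z) ^ n * (1 + z)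

theorem continuous_rookPoly : ∀ n, Continuous (rookPoly n)
  | 0 => continuous_const
  | n + 1 => by unfold rookPoly; fun_prop

theorem sum_range_rookPoly (n : ℕ) (z : ℂ) :
    ∑ i ∈ Finset.range (n + 1), rookPoly i z = (2 + z) ^ n := by
  induction n with
  | zero => simp [rookPoly]
  | succ n ih =>
    rw [Finset.sum_range_succ, ih, rookPoly]
    ring

/-- The circle average that turns out to be the number of rook walks to `(n, m)`. -/
noncomputable def rookAverage (n m : ℕ) : ℂ :=
  circleAverage (fun z => rookPoly n z * rookPoly m (starRingEnd ℂ z)) 0 1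

theorem circleAverage_comp_conj {E : Type*} [NormedAddCommGroup E] [NormedSpace ℝ E] (f : ℂ → E) :
    circleAverage (fun z => f (starRingEnd ℂ z)) 0 1 = circleAverage f 0 1 := by
  rw [← circleAverage_zero_one_congr_inv (f := f)]
  refine circleAverage_congr_sphere fun z hz => ?_
  have hz : ‖z‖ = 1 := by simpa using hz
  simp [Complex.inv_def, Complex.normSq_eq_norm_sq, hz]

theorem rookAverage_comm (n m : ℕ) : rookAverage n m = rookAverage m n := by
  rw [rookAverage, ← circleAverage_comp_conj, rookAverage]
  simp only [Complex.conj_conj, mul_comm]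

theorem circleAverage_eq_center_of_differentiable {f : ℂ → ℂ} (hf : Differentiable ℂ f) :
    circleAverage f 0 1 = f 0 :=
  hf.diffContOnCl.circleAverage

theorem Continuous.circleIntegrable_zero_one {f : ℂ → ℂ} (hf : Continuous f) :
    CircleIntegrable f 0 1 :=
  hf.continuousOn.circleIntegrable zero_le_one

theorem sum_rookAverage_left (n m : ℕ) :
    ∑ i ∈ Finset.range (n + 1), rookAverage i m =
      circleAverage (fun z => (2 + z) ^ n * rookPoly m (starRingEnd ℂ z)) 0 1 := by
  have hc := continuous_rookPoly
  simp only [rookAverage]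
  rw [← circleAverage_fun_sum]
  · simp only [← Finset.sum_mul, sum_range_rookPoly]
  · exact fun i _ => Continuous.circleIntegrable_zero_one <|
      (hc i).mul ((hc m).comp Complex.continuous_conj)

theorem sum_rookAverage_right (n m : ℕ) :
    ∑ j ∈ Finset.range (m + 1), rookAverage n j =
      circleAverage (fun z => rookPoly n z * (2 + starRingEnd ℂ z) ^ m) 0 1 := by
  simp only [rookAverage_comm n, sum_rookAverage_left]
  rw [← circleAverage_comp_conj]
  simp only [Complex.conj_conj, mul_comm]

theorem rookAverage_succ_zero (n : ℕ) :
    rookAverage (n + 1) 0 = ∑ i ∈ Finset.range (n + 1), rookAverage i 0 := by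
  rw [sum_rookAverage_left, rookAverage]
  simp only [rookPoly, mul_one]
  rw [circleAverage_eq_center_of_differentiable (by fun_prop),
    circleAverage_eq_center_of_differentiable (by fun_prop)]
  simp

theorem rookAverage_succ_succ (n m : ℕ) :
    rookAverage (n + 1) (m + 1) = ∑ i ∈ Finset.range (n + 1), rookAverage i (m + 1) +
      ∑ j ∈ Finset.range (m + 1), rookAverage (n + 1) j := by
  have hc := Complex.continuous_conj
  rw [sum_rookAverage_left, sum_rookAverage_right, rookAverage, ← circleAverage_fun_add]
  · refine circleAverage_congr_sphere fun z hz => ?_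
    have hz : ‖z‖ = 1 := by simpa using hz
    have h1 : z * starRingEnd ℂ z = 1 := by simp [Complex.mul_conj, Complex.normSq_eq_norm_sq, hz]
    simp only [rookPoly]
    linear_combination (2 + z) ^ n * (2 + starRingEnd ℂ z) ^ m * h1
  · apply Continuous.circleIntegrable_zero_one
    simp only [rookPoly]
    fun_prop
  · apply Continuous.circleIntegrable_zero_one
    simp only [rookPoly]
    fun_prop

theorem rookWalkCount_two_eq_rookAverage (n m : ℕ) :
    (rookWalkCount 2 ![n, m] : ℂ) = rookAverage n m := by
  refine rookWalkCount_two_eq_of_recurrence rookAverage ?_ ?_ n m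
  · simp [rookAverage, rookPoly, circleAverage_const]
  · rintro (_ | n) (_ | m) h
    · simp at h
    · rw [rookAverage_comm, rookAverage_succ_zero]
      simp [rookAverage_comm]
    · rw [rookAverage_succ_zero]
      simp
    · exact rookAverage_succ_succ n m

/-- The diagonal rook walk numbers as real integrals. -/
theorem rookWalkCount_diag_eq_integral (n : ℕ) :
    (rookWalkCount 2 (fun _ => n + 1) : ℝ) =
      (2 * π)⁻¹ * ∫ θ in -π..π, (5 + 4 * cos θ) ^ n * (2 + 2 * cos θ) := by
  have hv : (fun _ : Fin 2 => n + 1) = ![n + 1, n + 1] := by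
    ext i
    fin_cases i <;> rfl
  have hper : Function.Periodic (fun θ : ℝ => (5 + 4 * cos θ) ^ n * (2 + 2 * cos θ)) (2 * π) :=
    fun θ => by simp
  have hshift := hper.intervalIntegral_add_eq (-π) 0
  rw [zero_add, show -π + 2 * π = π by ring] at hshift
  rw [hshift, hv]
  apply Complex.ofReal_injective
  rw [Complex.ofReal_natCast, rookWalkCount_two_eq_rookAverage, rookAverage, circleAverage_def,
    Complex.ofReal_mul, ← intervalIntegral.integral_ofReal, Complex.real_smul]
  congr 1
  refine intervalIntegral.integral_congr fun θ _ => ?_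
  have h1 : circleMap 0 1 θ * starRingEnd ℂ (circleMap 0 1 θ) = 1 := by
    simp [Complex.mul_conj, Complex.normSq_eq_norm_sq]
  have h2 : circleMap 0 1 θ + starRingEnd ℂ (circleMap 0 1 θ) = 2 * (cos θ : ℂ) := by
    rw [Complex.add_conj]
    simp [circleMap, Complex.exp_ofReal_mul_I_re]
  simp only [rookPoly]
  generalize starRingEnd ℂ (circleMap 0 1 θ) = w at h1 h2
  generalize circleMap 0 1 θ = z at h1 h2
  have h5 : (2 + z) * (2 + w) = 5 + 4 * (cos θ : ℂ) := by linear_combination 2 * h2 + h1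
  have h6 : (1 + z) * (1 + w) = 2 + 2 * (cos θ : ℂ) := by linear_combination h2 + h1
  push_cast at h5 h6 ⊢
  rw [← h5, ← h6, mul_pow]
  ring

theorem tendsto_mul_cos_div_sqrt_sub_one (t : ℝ) :
    Tendsto (fun n : ℕ => (n : ℝ) * (cos (t / √n) - 1)) atTop (nhds (-(t ^ 2 / 2))) := by
  have hlim : Tendsto (fun n : ℕ => t ^ 4 * (5 / 96) / (n : ℝ)) atTop (nhds 0) :=
    tendsto_const_div_atTop_nhds_zero_nat _
  rw [tendsto_iff_dist_tendsto_zero]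
  refine squeeze_zero' (.of_forall fun _ => dist_nonneg) ?_ hlim
  filter_upwards [eventually_ge_atTop (max 1 ⌈t ^ 2⌉₊)] with n hn
  have hn1 : (1 : ℝ) ≤ n := by exact_mod_cast (le_max_left _ _).trans hn
  have hnt : t ^ 2 ≤ n := Nat.ceil_le.1 ((le_max_right _ _).trans hn)
  have hpos : (0 : ℝ) < n := by linarith
  have hsq : (t / √n) ^ 2 = t ^ 2 / n := by rw [div_pow, Real.sq_sqrt hpos.le]
  have hx : |t / √n| ≤ 1 := by
    rw [← sq_le_one_iff_abs_le_one, hsq, div_le_one hpos]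
    exact hnt
  have hb := Real.cos_bound hx
  have hq : |t / √n| ^ 4 = t ^ 4 / n ^ 2 := by
    rw [show |t / √n| ^ 4 = (|t / √n| ^ 2) ^ 2 by ring, sq_abs, hsq]
    ring
  rw [hq, hsq] at hb
  calc dist ((n : ℝ) * (cos (t / √n) - 1)) (-(t ^ 2 / 2))
      = n * |cos (t / √n) - (1 - t ^ 2 / n / 2)| := by
        rw [Real.dist_eq, ← abs_of_pos hpos, ← abs_mul, abs_of_pos hpos]
        congr 1
        field_simp
        ring
    _ ≤ n * (t ^ 4 / n ^ 2 * (5 / 96)) := by gcongr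
    _ = t ^ 4 * (5 / 96) / n := by field_simp

theorem tendsto_pow_mul_cos_div_sqrt (t : ℝ) :
    Tendsto (fun n : ℕ => ((5 + 4 * cos (t / √n)) / 9) ^ n * (2 + 2 * cos (t / √n))) atTop
      (nhds (exp (-(2 / 9) * t ^ 2) * 4)) := by
  refine Tendsto.mul ?_ ?_
  · have h := (tendsto_mul_cos_div_sqrt_sub_one t).const_mul (4 / 9)
    have h' := Real.tendsto_one_add_pow_exp_of_tendsto
      (g := fun n : ℕ => 4 / 9 * (cos (t / √n) - 1)) (t := -(2 / 9) * t ^ 2)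
      (by convert h using 2 <;> ring)
    refine h'.congr fun n => ?_
    congr 1
    ring
  · have h0 : Tendsto (fun n : ℕ => t / √(n : ℝ)) atTop (nhds 0) :=
      tendsto_const_nhds.div_atTop
        (Real.tendsto_sqrt_atTop.comp tendsto_natCast_atTop_atTop)
    have h1 := (Real.continuous_cos.tendsto 0).comp h0
    rw [Real.cos_zero] at h1
    have h2 := (h1.const_mul 2).const_add 2
    norm_num at h2
    exact h2

theorem pow_mul_cos_le_exp {θ : ℝ} (hθ : |θ| ≤ π) (n : ℕ) :
    |((5 + 4 * cos θ) / 9) ^ n * (2 + 2 * cos θ)| ≤ 4 * exp (-(8 / (9 * π ^ 2)) * (n * θ ^ 2)) := by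
  have h1 := Real.neg_one_le_cos θ
  have h2 := Real.cos_le_one θ
  have hquad : cos θ ≤ 1 - 2 / π ^ 2 * θ ^ 2 := Real.cos_le_one_sub_mul_cos_sq hθ
  have hbase : (5 + 4 * cos θ) / 9 ≤ exp (-(8 / (9 * π ^ 2)) * θ ^ 2) := by
    refine le_trans ?_ (Real.add_one_le_exp _)
    have : 8 / (9 * π ^ 2) = 4 / 9 * (2 / π ^ 2) := by ring
    rw [this]
    linarith
  have h0 : 0 ≤ (5 + 4 * cos θ) / 9 := by linarith
  rw [abs_of_nonneg (mul_nonneg (pow_nonneg h0 n) (by linarith)), mul_comm]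
  refine mul_le_mul (by linarith) ?_ (pow_nonneg h0 n) (by norm_num)
  calc ((5 + 4 * cos θ) / 9) ^ n ≤ exp (-(8 / (9 * π ^ 2)) * θ ^ 2) ^ n := by gcongr
    _ = exp (-(8 / (9 * π ^ 2)) * (n * θ ^ 2)) := by
      rw [← Real.exp_nat_mul]
      ring_nf

open MeasureTheory in
/-- Laplace's method for the integral over a period. -/
theorem tendsto_sqrt_mul_integral :
    Tendsto (fun n : ℕ => √n * ∫ θ in -π..π, ((5 + 4 * cos θ) / 9) ^ n * (2 + 2 * cos θ)) atTop
      (nhds (√(π / (2 / 9)) * 4)) := by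
  set F : ℕ → ℝ → ℝ := fun n => (Set.Ioc (-π) π).indicator
    (fun θ => ((5 + 4 * cos θ) / 9) ^ n * (2 + 2 * cos θ)) with hF
  have hlim : Tendsto (fun n : ℕ => ∫ t : ℝ, F n (t / √n)) atTop
      (nhds (∫ t : ℝ, exp (-(2 / 9) * t ^ 2) * 4)) := by
    refine tendsto_integral_filter_of_dominated_convergence
      (fun t => 4 * exp (-(8 / (9 * π ^ 2)) * t ^ 2)) ?_ ?_ ?_ ?_
    · refine .of_forall fun n => ?_
      refine Measurable.aestronglyMeasurable ?_
      refine Measurable.comp (Measurable.indicator ?_ measurableSet_Ioc) (by fun_prop)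
      exact Continuous.measurable (by fun_prop)
    · filter_upwards [eventually_gt_atTop 0] with n hn
      have hn : (0 : ℝ) < n := by exact_mod_cast hn
      refine .of_forall fun t => ?_
      by_cases ht : t / √n ∈ Set.Ioc (-π) π
      · rw [hF]
        simp only [Set.indicator_of_mem ht, Real.norm_eq_abs]
        refine (pow_mul_cos_le_exp (abs_le.2 ⟨ht.1.le, ht.2⟩) n).trans_eq ?_
        rw [div_pow, Real.sq_sqrt hn.le, mul_div_cancel₀ _ hn.ne']
      · rw [hF]
        simp only [Set.indicator_of_notMem ht, norm_zero]
        positivity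
    · exact (integrable_exp_neg_mul_sq (by positivity)).const_mul 4
    · refine .of_forall fun t => ?_
      refine (tendsto_pow_mul_cos_div_sqrt t).congr' ?_
      have h0 : Tendsto (fun n : ℕ => t / √(n : ℝ)) atTop (nhds 0) :=
        tendsto_const_nhds.div_atTop
          (Real.tendsto_sqrt_atTop.comp tendsto_natCast_atTop_atTop)
      filter_upwards [h0.eventually (Ioo_mem_nhds (neg_lt_zero.2 Real.pi_pos) Real.pi_pos)] with n hn
      simp only [hF, Set.indicator_of_mem (Set.Ioo_subset_Ioc_self hn)]
  rw [integral_mul_const, integral_gaussian] at hlim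
  refine hlim.congr fun n => ?_
  rw [Measure.integral_comp_div, abs_of_nonneg (Real.sqrt_nonneg _), smul_eq_mul, hF,
    integral_indicator measurableSet_Ioc,
    intervalIntegral.integral_of_le (by linarith [Real.pi_pos])]

/-- Asymptotics of diagonal 2-dimensional rook walk numbers:
`a(n,n) ~ √(2/(πn)) · 3^{2n−1}` as `n → ∞`. -/
theorem rook_diag_asymptotics_two_dim :
    Filter.Tendsto
      (fun n : ℕ =>
        (rookWalkCount 2 (fun _ => n) : ℝ) /
          (Real.sqrt (2 / (Real.pi * n)) * ((3 : ℝ) ^ (2 * n) / 3)))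
      Filter.atTop (nhds 1) := by
  rw [← tendsto_add_atTop_iff_nat 1]
  have hratio : Tendsto (fun n : ℕ => √(((n + 1 : ℕ) : ℝ) / n)) atTop (nhds 1) := by
    have h := (tendsto_one_div_atTop_nhds_zero_nat (𝕜 := ℝ)).const_add 1
    have h' := (Real.continuous_sqrt.tendsto _).comp h
    rw [add_zero, Real.sqrt_one] at h'
    refine h'.congr' ?_
    filter_upwards [eventually_gt_atTop 0] with n hn
    have hn : (n : ℝ) ≠ 0 := by positivity
    simp only [Function.comp]
    congr 1
    push_cast
    field_simp
  have hmain := (hratio.mul tendsto_sqrt_mul_integral).const_mul ((2 * π)⁻¹ / 3 * √(π / 2))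
  have hconst : (2 * π)⁻¹ / 3 * √(π / 2) * (1 * (√(π / (2 / 9)) * 4)) = 1 := by
    have h9 : √(π / (2 / 9)) = 3 * √(π / 2) := by
      rw [show π / (2 / 9) = 3 ^ 2 * (π / 2) by ring, Real.sqrt_mul (by norm_num),
        Real.sqrt_sq (by norm_num)]
    have hs : √(π / 2) * √(π / 2) = π / 2 := Real.mul_self_sqrt (by positivity)
    have hpi := Real.pi_ne_zero
    rw [h9, show (2 * π)⁻¹ / 3 * √(π / 2) * (1 * (3 * √(π / 2) * 4)) =
      (2 * π)⁻¹ * 4 * (√(π / 2) * √(π / 2)) by ring, hs]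
    field_simp
    norm_num
  rw [hconst] at hmain
  refine hmain.congr' ?_
  filter_upwards [eventually_gt_atTop 0] with n hn
  have hn : (0 : ℝ) < n := by exact_mod_cast hn
  have hint : (∫ θ in -π..π, (5 + 4 * cos θ) ^ n * (2 + 2 * cos θ)) =
      9 ^ n * ∫ θ in -π..π, ((5 + 4 * cos θ) / 9) ^ n * (2 + 2 * cos θ) := by
    rw [← intervalIntegral.integral_const_mul]
    refine intervalIntegral.integral_congr fun θ _ => ?_
    simp only [div_pow]
    field_simp
  rw [rookWalkCount_diag_eq_integral, hint]
  have hn1 : (0 : ℝ) < ((n + 1 : ℕ) : ℝ) := by positivity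
  have hpow : (3 : ℝ) ^ (2 * (n + 1)) = 9 * 9 ^ n := by
    rw [pow_mul, pow_succ]
    norm_num
    ring
  rw [hpow, Real.sqrt_div hn1.le, Real.sqrt_div Real.pi_pos.le, Real.sqrt_div zero_le_two,
    Real.sqrt_mul Real.pi_pos.le]
  have e1 := (Real.sqrt_pos.2 hn).ne'
  have e2 := (Real.sqrt_pos.2 hn1).ne'
  have e3 := (Real.sqrt_pos.2 Real.pi_pos).ne'
  have e4 := (Real.sqrt_pos.2 (zero_lt_two (α := ℝ))).ne'
  field_simp
  norm_num
end

section
/- Let a_n = a_3(n,n,n) be the number of 3-dimensional rook walks from the origin to (n,n,n). Then a_n ~ (9√3/(40πn)) · 64^n as n → ∞; that is, the quotient a_n / ((9√3/(40πn)) · 64^n) tends to 1 as n → ∞. -/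
open Filter Real

section ListSums

/-- A list is either empty or has a head and a tail. -/
def nilSumConsEquiv (α : Type*) : Unit ⊕ (α × List α) ≃ List α where
  toFun := Sum.elim (fun _ => []) (fun p => p.1 :: p.2)
  invFun L := match L with
    | [] => Sum.inl ()
    | a :: L => Sum.inr (a, L)
  left_inv := by rintro (_ | ⟨a, L⟩) <;> rfl
  right_inv := by rintro (_ | ⟨a, L⟩) <;> rfl

theorem tsum_list_eq_nil_add_cons {α M : Type*} [AddCommMonoid M] [TopologicalSpace M]
    [ContinuousAdd M] [T2Space M] {f : List α → M}
    (hf : Summable fun p : α × List α => f (p.1 :: p.2)) :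
    ∑' L, f L = f [] + ∑' p : α × List α, f (p.1 :: p.2) := by
  rw [← (nilSumConsEquiv α).tsum_eq f,
    Summable.tsum_sum (f := fun c => f (nilSumConsEquiv α c)) (Summable.of_finite) hf]
  simp [nilSumConsEquiv]

theorem ENNReal.tsum_list_prod_le {α : Type*} (w : α → ENNReal) :
    ∑' L : List α, (L.map w).prod ≤ (1 - ∑' a, w a)⁻¹ := by
  set q := ∑' a, w a with hq
  have bounded : ∀ N : ℕ, ∑' L : List α, (if L.length < N then (L.map w).prod else 0)
      ≤ ∑' k : ℕ, q ^ k := by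
    intro N
    refine le_trans ?_ (ENNReal.sum_le_tsum (Finset.range N))
    induction N with
    | zero => simp
    | succ N ih =>
      rw [tsum_list_eq_nil_add_cons ENNReal.summable, ENNReal.tsum_prod', Finset.sum_range_succ']
      simp only [List.length_nil, Nat.succ_pos, if_true, List.map_nil, List.prod_nil,
        List.length_cons, add_lt_add_iff_right, List.map_cons, List.prod_cons, pow_zero,
        pow_succ', ← mul_ite_zero, ENNReal.tsum_mul_left, ENNReal.tsum_mul_right,
        ← Finset.mul_sum]
      rw [add_comm]
      gcongr
  rw [← ENNReal.tsum_geometric, ENNReal.tsum_eq_iSup_sum]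
  refine iSup_le fun s => ?_
  refine le_trans ?_ (bounded (s.sup List.length + 1))
  refine le_trans (Finset.sum_le_sum fun L hL => ?_) (ENNReal.sum_le_tsum s)
  rw [if_pos (Nat.lt_succ_of_le (Finset.le_sup (f := List.length) hL))]

theorem summable_norm_list_prod {α : Type*} {w : α → ℂ} (hw : Summable fun a => ‖w a‖)
    (hlt : ∑' a, ‖w a‖ < 1) : Summable fun L : List α => ‖(L.map w).prod‖ := by
  have key := ENNReal.tsum_list_prod_le fun a => ‖w a‖ₑ
  have hsum : ∑' a, ‖w a‖ₑ < 1 := by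
    simp only [← ofReal_norm]
    rw [← ENNReal.ofReal_tsum_of_nonneg (fun _ => norm_nonneg _) hw]
    simpa using hlt
  have hne : ∑' L : List α, ‖(L.map w).prod‖ₑ ≠ ⊤ := by
    refine ne_top_of_le_ne_top (b := (1 - ∑' a, ‖w a‖ₑ)⁻¹) ?_ ?_
    · exact ENNReal.inv_ne_top.2 (tsub_pos_of_lt hsum).ne'
    · refine le_trans (le_of_eq (tsum_congr fun L => ?_)) key
      induction L with
      | nil => simp
      | cons a L ih => simp [enorm_mul, ih]
  simpa using ENNReal.summable_toReal hne

end ListSums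

section RookWeights

/-- The weight `c i ^ j` of a rook step of length `j` in direction `i`. -/
noncomputable def rookStepWeight (c : Fin 3 → ℂ) (s : Fin 3 × ℕ) : ℂ :=
  if 0 < s.2 then c s.1 ^ s.2 else 0

/-- The total displacement of a sequence of steps in direction `i`. -/
def rookDisplacement (i : Fin 3) (L : List (Fin 3 × ℕ)) : ℕ :=
  (L.map fun s => if s.1 = i then s.2 else 0).sum

theorem rookDisplacement_cons (i : Fin 3) (s : Fin 3 × ℕ) (L : List (Fin 3 × ℕ)) :
    rookDisplacement i (s :: L) = (if s.1 = i then s.2 else 0) + rookDisplacement i L := by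
  simp [rookDisplacement]

/-- The weight of a sequence of steps is the product of the step weights. -/
noncomputable def rookWeight (c : Fin 3 → ℂ) (L : List (Fin 3 × ℕ)) : ℂ :=
  (L.map (rookStepWeight c)).prod

open Classical in
theorem rookWeight_eq (c : Fin 3 → ℂ) (L : List (Fin 3 × ℕ)) :
    rookWeight c L =
      if ∀ s ∈ L, 0 < s.2 then ∏ i, c i ^ rookDisplacement i L else 0 := by
  induction L with
  | nil => simp [rookWeight, rookDisplacement]
  | cons s L ih =>
    have hcons : rookWeight c (s :: L) = rookStepWeight c s * rookWeight c L := by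
      simp [rookWeight]
    rw [hcons, ih]
    by_cases hs : 0 < s.2
    · by_cases hL : ∀ s ∈ L, 0 < s.2
      · rw [if_pos hL, if_pos (by simpa using ⟨hs, by simpa using hL⟩)]
        simp only [rookDisplacement_cons, pow_add, Finset.prod_mul_distrib]
        simp [rookStepWeight, hs, pow_ite]
      · rw [if_neg hL, if_neg fun h => hL fun t ht => h t (List.mem_cons_of_mem _ ht), mul_zero]
    · simp [rookStepWeight, hs]

theorem hasSum_ite_pos_pow {K : Type*} [NormedField K] {x : K} (hx : ‖x‖ < 1) :
    HasSum (fun j : ℕ => if 0 < j then x ^ j else 0) ((1 - x)⁻¹ - 1) := by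
  have h := hasSum_geometric_of_norm_lt_one hx
  have h0 : HasSum (fun j : ℕ => if j = 0 then (1 : K) else 0) 1 := hasSum_ite_eq 0 1
  refine (h.sub h0).congr_fun fun j => ?_
  rcases Nat.eq_zero_or_pos j with rfl | hj
  · simp
  · simp [hj, hj.ne']

theorem summable_norm_rookWeight {c : Fin 3 → ℂ} (hc : ∀ i, ‖c i‖ < 1)
    (hlt : ∑ i, ((1 - ‖c i‖)⁻¹ - 1) < 1) : Summable fun L => ‖rookWeight c L‖ := by
  have hrow : ∀ i, HasSum (fun j : ℕ => ‖rookStepWeight c (i, j)‖) ((1 - ‖c i‖)⁻¹ - 1) := by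
    intro i
    refine (hasSum_ite_pos_pow (x := ‖c i‖) (by simpa using hc i)).congr_fun fun j => ?_
    simp only [rookStepWeight]
    split_ifs <;> simp
  have hsum : Summable fun s : Fin 3 × ℕ => ‖rookStepWeight c s‖ :=
    (summable_prod_of_nonneg fun _ => norm_nonneg _).2
      ⟨fun i => (hrow i).summable, Summable.of_finite⟩
  refine summable_norm_list_prod hsum ?_
  rw [hsum.tsum_prod, tsum_fintype]
  simpa only [(hrow _).tsum_eq] using hlt

/-- The contribution of the sequences with displacement `m` in the third direction, where the
first two directions are weighted by `x` and `y`. -/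
noncomputable def rookLevelTerm (x y : ℂ) (m : ℕ) (L : List (Fin 3 × ℕ)) : ℂ :=
  if rookDisplacement 2 L = m then rookWeight ![x, y, 1] L else 0

theorem summable_norm_rookLevelTerm {x y : ℂ} (hx : ‖x‖ = 1 / 4) (hy : ‖y‖ = 1 / 4) (m : ℕ) :
    Summable fun L => ‖rookLevelTerm x y m L‖ := by
  have h : Summable fun L => ‖rookWeight ![x, y, 1 / 8] L‖ := by
    apply summable_norm_rookWeight
    · intro i
      fin_cases i <;> norm_num [hx, hy]
    · simp only [Fin.sum_univ_three, Matrix.cons_val, hx, hy]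
      norm_num
  refine Summable.of_nonneg_of_le (fun _ => norm_nonneg _) (fun L => ?_) (h.mul_left (8 ^ m))
  rw [rookLevelTerm]
  split_ifs with hL
  · rw [rookWeight_eq, rookWeight_eq]
    split_ifs with hpos
    · simp only [Fin.prod_univ_three, hL]
      simp only [Matrix.cons_val, norm_mul, norm_pow, one_pow, norm_one]
      norm_num
      field_simp
      rw [← mul_pow]
      norm_num
    · simp
  · simp only [norm_zero]
    positivity

theorem rookLevelTerm_cons (x y : ℂ) (m : ℕ) (s : Fin 3 × ℕ) (L : List (Fin 3 × ℕ)) :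
    rookLevelTerm x y m (s :: L) =
      if (if s.1 = 2 then s.2 else 0) ≤ m then
        rookStepWeight ![x, y, 1] s * rookLevelTerm x y (m - if s.1 = 2 then s.2 else 0) L
      else 0 := by
  simp only [rookLevelTerm, rookDisplacement_cons, rookWeight, List.map_cons, List.prod_cons]
  generalize (if s.1 = 2 then s.2 else 0) = k
  by_cases hk : k ≤ m
  · have : k + rookDisplacement 2 L = m ↔ rookDisplacement 2 L = m - k := by omega
    simp [hk, this]
  · rw [if_neg hk, if_neg (by omega)]

/-- Decomposition of a walk according to its first step. -/
theorem tsum_rookLevelTerm_first_step {x y : ℂ} (hx : ‖x‖ = 1 / 4) (hy : ‖y‖ = 1 / 4) (m : ℕ) :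
    ∑' L, rookLevelTerm x y m L = (if m = 0 then 1 else 0)
      + ((1 - x)⁻¹ - 1 + ((1 - y)⁻¹ - 1)) * ∑' L, rookLevelTerm x y m L
      + ∑ k ∈ Finset.range m, ∑' L, rookLevelTerm x y k L := by
  have hs : ∀ k, Summable (rookLevelTerm x y k) :=
    fun k => (summable_norm_rookLevelTerm hx hy k).of_norm
  have hcons : Summable fun p : (Fin 3 × ℕ) × List (Fin 3 × ℕ) =>
      rookLevelTerm x y m (p.1 :: p.2) :=
    (hs m).comp_injective (i := fun p : (Fin 3 × ℕ) × List (Fin 3 × ℕ) => p.1 :: p.2)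
      (by rintro ⟨a, L⟩ ⟨b, K⟩ h; simpa using h)
  have hnil : rookLevelTerm x y m [] = if m = 0 then 1 else 0 := by
    simp [rookLevelTerm, rookDisplacement, rookWeight, eq_comm]
  have hx1 := (hasSum_ite_pos_pow (x := x) (by rw [hx]; norm_num)).tsum_eq
  have hy1 := (hasSum_ite_pos_pow (x := y) (by rw [hy]; norm_num)).tsum_eq
  have hlast : ∑' j : ℕ, (if j ≤ m then rookStepWeight ![x, y, 1] (2, j) *
      ∑' L, rookLevelTerm x y (m - j) L else 0) =
      ∑ k ∈ Finset.range m, ∑' L, rookLevelTerm x y k L := by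
    rw [tsum_eq_sum (s := Finset.range (m + 1)) (by
      intro j hj
      rw [if_neg (by simpa using hj)])]
    rw [Finset.sum_range_succ', ← Finset.sum_range_reflect]
    simp only [rookStepWeight]
    simp only [lt_irrefl, if_false, zero_mul, ite_self, add_zero]
    refine Finset.sum_congr rfl fun j hj => ?_
    have hj' : j < m := Finset.mem_range.1 hj
    rw [if_pos (by omega), if_pos (by omega)]
    have : m - (m - 1 - j + 1) = j := by omega
    simp [this]
  refine (tsum_list_eq_nil_add_cons hcons).trans ?_
  rw [hnil, add_assoc]
  congr 1
  rw [hcons.tsum_prod, hcons.prod.tsum_prod, tsum_fintype, Fin.sum_univ_three, ← hlast, ← hx1,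
    ← hy1, add_mul, ← tsum_mul_right, ← tsum_mul_right]
  simp only [rookLevelTerm_cons]
  congr 1
  · congr 1 <;> simp [tsum_mul_left, rookStepWeight, -ite_mul]
  · refine tsum_congr fun j => ?_
    simp only [if_true]
    split_ifs
    · rw [tsum_mul_left]
    · simp

theorem tsum_rookLevelTerm_succ {x y B : ℂ} (hx : ‖x‖ = 1 / 4) (hy : ‖y‖ = 1 / 4)
    (hB : B = 3 - (1 - x)⁻¹ - (1 - y)⁻¹) (hB0 : B ≠ 0) (m : ℕ) :
    ∑' L, rookLevelTerm x y (m + 1) L = (1 + B⁻¹) ^ m * (B⁻¹) ^ 2 := by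
  have hrec : ∀ k, B * ∑' L, rookLevelTerm x y k L = (if k = 0 then 1 else 0)
      + ∑ i ∈ Finset.range k, ∑' L, rookLevelTerm x y i L := by
    intro k
    have := tsum_rookLevelTerm_first_step hx hy k
    rw [hB]
    linear_combination this
  induction m with
  | zero =>
    have h0 := hrec 0
    have h1 := hrec 1
    simp only [Finset.sum_range_succ, Finset.range_zero, Finset.sum_empty] at h0 h1
    norm_num at h0 h1
    field_simp
    linear_combination B * h1 + h0
  | succ m ih =>
    have h1 := hrec (m + 1)
    have h2 := hrec (m + 2)
    rw [Finset.sum_range_succ] at h2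
    norm_num at h1 h2
    have h3 : B * ∑' L, rookLevelTerm x y (m + 2) L
        = (B + 1) * ∑' L, rookLevelTerm x y (m + 1) L := by
      linear_combination h2 - h1
    rw [ih] at h3
    rw [← mul_right_inj' hB0, h3, pow_succ]
    linear_combination -(1 + B⁻¹) ^ m * (B⁻¹) ^ 2 * mul_inv_cancel₀ hB0

end RookWeights

section FourierExtraction

open MeasureTheory

theorem setIntegral_exp_int_mul (k : ℤ) :
    ∫ θ in Set.Ioc (-π) π, Complex.exp (k * Complex.I * (θ : ℂ)) =
      if k = 0 then 2 * (π : ℂ) else 0 := by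
  rw [← intervalIntegral.integral_of_le (by linarith [pi_pos])]
  split_ifs with hk
  · simp [hk]
    ring
  · have hne : (k : ℂ) * Complex.I ≠ 0 := by simp [hk]
    rw [integral_exp_mul_complex hne, div_eq_zero_iff]
    left
    rw [sub_eq_zero, Complex.exp_eq_exp_iff_exists_int]
    exact ⟨k, by push_cast; ring⟩

/-- The point at angle `θ` of the circle of radius `1 / 4`. -/
noncomputable def quarterCircle (θ : ℝ) : ℂ := Complex.exp (θ * Complex.I) / 4

theorem norm_quarterCircle (θ : ℝ) : ‖quarterCircle θ‖ = 1 / 4 := by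
  simp [quarterCircle, Complex.norm_exp_ofReal_mul_I]

theorem continuous_quarterCircle : Continuous quarterCircle := by
  unfold quarterCircle
  fun_prop

/-- The square of angles on which Fourier coefficients are computed. -/
def angleSquare : Set (ℝ × ℝ) := Set.Ioc (-π) π ×ˢ Set.Ioc (-π) π

theorem measurableSet_angleSquare : MeasurableSet angleSquare :=
  measurableSet_Ioc.prod measurableSet_Ioc

/-- The character `exp (-i (θ₁ + θ₂))`. -/
noncomputable def diagCharacter (p : ℝ × ℝ) : ℂ :=
  Complex.exp (-(p.1 * Complex.I)) * Complex.exp (-(p.2 * Complex.I))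

theorem norm_diagCharacter (p : ℝ × ℝ) : ‖diagCharacter p‖ = 1 := by
  have h : ∀ θ : ℝ, ‖Complex.exp (-(θ * Complex.I))‖ = 1 := by
    intro θ
    have := Complex.norm_exp_ofReal_mul_I (-θ)
    simpa using this
  simp [diagCharacter, h]

theorem continuous_diagCharacter : Continuous diagCharacter := by
  unfold diagCharacter
  fun_prop

open Classical in
theorem diagCharacter_pow_mul_rookLevelTerm (n : ℕ) (L : List (Fin 3 × ℕ)) (p : ℝ × ℝ) :
    diagCharacter p ^ n * rookLevelTerm (quarterCircle p.1) (quarterCircle p.2) n L =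
      (if (∀ s ∈ L, 0 < s.2) ∧ rookDisplacement 2 L = n then
        (1 / 4 : ℂ) ^ (rookDisplacement 0 L + rookDisplacement 1 L) else 0) *
      (Complex.exp (((rookDisplacement 0 L - n : ℤ) : ℂ) * Complex.I * (p.1 : ℂ)) *
        Complex.exp (((rookDisplacement 1 L - n : ℤ) : ℂ) * Complex.I * (p.2 : ℂ))) := by
  rw [rookLevelTerm, rookWeight_eq]
  by_cases h2 : rookDisplacement 2 L = n
  · by_cases hL : ∀ s ∈ L, 0 < s.2
    · rw [if_pos h2, if_pos hL, if_pos ⟨hL, h2⟩]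
      simp only [Fin.prod_univ_three, Matrix.cons_val, one_pow, mul_one, quarterCircle,
        diagCharacter, mul_pow, div_pow, ← Complex.exp_nat_mul, pow_add]
      have split : ∀ (k : ℕ) (θ : ℝ),
          Complex.exp (((k - n : ℤ) : ℂ) * Complex.I * (θ : ℂ)) =
          Complex.exp (n * -(θ * Complex.I)) * Complex.exp (k * (θ * Complex.I)) := by
        intro k θ
        rw [← Complex.exp_add]
        congr 1
        push_cast
        ring
      rw [split, split]
      ring
    · rw [if_neg hL, if_neg (c := _ ∧ _) fun h => hL h.1, ite_self, mul_zero, zero_mul]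
  · simp [h2]

theorem rookWalkCount_eq_setIntegral (n : ℕ) :
    (rookWalkCount 3 (fun _ => n) : ℂ) * ((1 / 4) ^ (n + n) * (2 * π) ^ 2) =
      ∫ p in angleSquare, diagCharacter p ^ n *
        ∑' L, rookLevelTerm (quarterCircle p.1) (quarterCircle p.2) n L := by
  classical
  set F : List (Fin 3 × ℕ) → ℝ × ℝ → ℂ := fun L p =>
    diagCharacter p ^ n * rookLevelTerm (quarterCircle p.1) (quarterCircle p.2) n L with hF
  have hfin : volume angleSquare ≠ ⊤ := by
    rw [angleSquare, Measure.volume_eq_prod, Measure.prod_prod]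
    simp [ENNReal.mul_eq_top]
  have hnorm : ∀ L p, ‖F L p‖ = ‖rookLevelTerm (quarterCircle 0) (quarterCircle 0) n L‖ := by
    intro L p
    have hF0 : ‖F L 0‖ = ‖rookLevelTerm (quarterCircle 0) (quarterCircle 0) n L‖ := by
      simp [hF, norm_diagCharacter]
    rw [← hF0]
    simp only [hF, diagCharacter_pow_mul_rookLevelTerm, norm_mul]
    have h : ∀ (k : ℤ) (θ : ℝ), ‖Complex.exp ((k : ℂ) * Complex.I * (θ : ℂ))‖ = 1 := by
      intro k θ
      rw [← Complex.norm_exp_ofReal_mul_I (k * θ)]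
      congr 2
      push_cast
      ring
    simp only [h]
  have hcont : ∀ L, Continuous (F L) := by
    intro L
    simp only [hF, diagCharacter_pow_mul_rookLevelTerm]
    fun_prop
  have hint : ∀ L, Integrable (F L) (volume.restrict angleSquare) := by
    intro L
    refine Measure.integrableOn_of_bounded hfin (hcont L).aestronglyMeasurable
      (M := ‖rookLevelTerm (quarterCircle 0) (quarterCircle 0) n L‖) ?_
    exact ae_of_all _ fun p => (hnorm L p).le
  have hsum : Summable fun L => ∫ p in angleSquare, ‖F L p‖ := by
    simp only [hnorm, integral_const, smul_eq_mul]
    exact (summable_norm_rookLevelTerm (norm_quarterCircle 0) (norm_quarterCircle 0) n).mul_left _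
  have hval : ∀ L, ∫ p in angleSquare, F L p =
      (RookWalks 3 fun _ => n).indicator (fun _ => (1 / 4 : ℂ) ^ (n + n) * (2 * π) ^ 2) L := by
    intro L
    simp only [hF, diagCharacter_pow_mul_rookLevelTerm]
    rw [integral_const_mul, angleSquare, Measure.volume_eq_prod,
      setIntegral_prod_mul (fun θ : ℝ => Complex.exp (_ * Complex.I * (θ : ℂ)))
        (fun θ : ℝ => Complex.exp (_ * Complex.I * (θ : ℂ))),
      setIntegral_exp_int_mul, setIntegral_exp_int_mul]
    have hmem : L ∈ RookWalks 3 (fun _ => n) ↔ ((∀ s ∈ L, 0 < s.2) ∧ rookDisplacement 2 L = n) ∧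
        rookDisplacement 0 L = n ∧ rookDisplacement 1 L = n := by
      simp only [RookWalks, Set.mem_ofPred_eq, Fin.forall_fin_succ (n := 2),
        Fin.forall_fin_two, rookDisplacement]
      tauto
    have hz : ∀ k : ℕ, ((k : ℤ) - n = 0) ↔ k = n := by intro k; omega
    simp only [Set.indicator_apply, hmem, hz]
    by_cases h1 : (∀ s ∈ L, 0 < s.2) ∧ rookDisplacement 2 L = n
    · by_cases h2 : rookDisplacement 0 L = n
      · by_cases h3 : rookDisplacement 1 L = n
        · rw [if_pos h1, if_pos h2, if_pos h3, if_pos ⟨h1, h2, h3⟩, h2, h3]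
          ring
        · simp [h3]
      · simp [h2]
    · rw [if_neg h1, if_neg (c := _ ∧ _) (fun h => h1 h.1), zero_mul]
  have := (hasSum_integral_of_summable_integral_norm hint hsum).tsum_eq
  simp only [hval] at this
  rw [← tsum_subtype, tsum_const] at this
  simp only [hF, tsum_mul_left] at this
  rw [← this, rookWalkCount, nsmul_eq_mul, Nat.card_coe_set_eq]

end FourierExtraction

section Asymptotics

open MeasureTheory Topology

theorem re_inv_one_sub_quarterCircle_le {θ : ℝ} (hθ : |θ| ≤ π) :
    ((1 - quarterCircle θ)⁻¹).re ≤ 4 / 3 - 8 / (15 * π ^ 2) * θ ^ 2 := by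
  have hcos := cos_le_one_sub_mul_cos_sq hθ
  have hre : (1 - quarterCircle θ).re = 1 - cos θ / 4 := by
    simp [quarterCircle, Complex.exp_ofReal_mul_I_re]
  have him : (1 - quarterCircle θ).im = -(sin θ / 4) := by
    simp [quarterCircle, Complex.exp_ofReal_mul_I_im]
  have hval : ((1 - quarterCircle θ)⁻¹).re = (16 - 4 * cos θ) / (17 - 8 * cos θ) := by
    have hpos : 0 < 17 - 8 * cos θ := by linarith [cos_le_one θ]
    have hsq : Complex.normSq (1 - quarterCircle θ) = (17 - 8 * cos θ) / 16 := by
      rw [Complex.normSq_apply, hre, him]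
      linear_combination (1 / 16) * sin_sq_add_cos_sq θ
    rw [Complex.inv_re, hsq, hre]
    field_simp
    ring
  have hbound : (16 - 4 * cos θ) / (17 - 8 * cos θ) ≤ 4 / 3 - 4 / 15 * (1 - cos θ) := by
    rw [div_le_iff₀ (by linarith [cos_le_one θ])]
    nlinarith [mul_nonneg (sub_nonneg.2 (cos_le_one θ)) (by linarith [neg_one_le_cos θ] :
      0 ≤ 1 + cos θ)]
  have hrw : 8 / (15 * π ^ 2) * θ ^ 2 = 4 / 15 * (2 / π ^ 2 * θ ^ 2) := by
    field_simp
    ring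
  rw [hval, hrw]
  linarith

/-- The denominator `1 - x / (1 - x) - y / (1 - y)` of the two-dimensional rook walk generating
function, on the torus of radius `1 / 4`. -/
noncomputable def rookDenom (p : ℝ × ℝ) : ℂ :=
  3 - (1 - quarterCircle p.1)⁻¹ - (1 - quarterCircle p.2)⁻¹

theorem one_sub_quarterCircle_ne_zero (θ : ℝ) : 1 - quarterCircle θ ≠ 0 := by
  intro h
  have := norm_quarterCircle θ
  rw [← sub_eq_zero.1 h] at this
  norm_num at this

theorem continuous_rookDenom : Continuous rookDenom := by
  unfold rookDenom
  have h := continuous_quarterCircle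
  refine (continuous_const.sub (Continuous.inv₀ (by fun_prop) fun p =>
    one_sub_quarterCircle_ne_zero _)).sub (Continuous.inv₀ (by fun_prop) fun p =>
    one_sub_quarterCircle_ne_zero _)

theorem le_re_rookDenom {p : ℝ × ℝ} (hp : p ∈ angleSquare) :
    1 / 3 + 8 / (15 * π ^ 2) * (p.1 ^ 2 + p.2 ^ 2) ≤ (rookDenom p).re := by
  obtain ⟨⟨h1, h2⟩, h3, h4⟩ := hp
  have hx := re_inv_one_sub_quarterCircle_le (abs_le.2 ⟨h1.le, h2⟩)
  have hy := re_inv_one_sub_quarterCircle_le (abs_le.2 ⟨h3.le, h4⟩)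
  have : (rookDenom p).re =
      3 - ((1 - quarterCircle p.1)⁻¹).re - ((1 - quarterCircle p.2)⁻¹).re := by
    simp [rookDenom]
  rw [this, mul_add]
  linarith

theorem third_le_re_rookDenom {p : ℝ × ℝ} (hp : p ∈ angleSquare) :
    1 / 3 ≤ (rookDenom p).re :=
  le_trans (le_add_of_nonneg_right (by positivity)) (le_re_rookDenom hp)

/-- The function whose powers carry the exponential growth of the Fourier integrand. -/
noncomputable def rookKernel (p : ℝ × ℝ) : ℂ :=
  diagCharacter p * (1 + (rookDenom p)⁻¹) / 4

/-- The amplitude of the Fourier integrand. -/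
noncomputable def rookAmplitude (p : ℝ × ℝ) : ℂ :=
  (rookDenom p)⁻¹ * (1 + rookDenom p)⁻¹

theorem norm_rookKernel_le {p : ℝ × ℝ} (hp : p ∈ angleSquare) :
    ‖rookKernel p‖ ≤ exp (-(4 / (15 * π ^ 2) * (p.1 ^ 2 + p.2 ^ 2))) := by
  set s := 8 / (15 * π ^ 2) * (p.1 ^ 2 + p.2 ^ 2) with hs
  have hs0 : 0 ≤ s := by positivity
  have hs1 : s ≤ 16 / 15 := by
    obtain ⟨⟨h1, h2⟩, h3, h4⟩ := hp
    have hx : p.1 ^ 2 ≤ π ^ 2 := sq_le_sq.2 (by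
      rw [abs_of_pos pi_pos]; exact abs_le.2 ⟨h1.le, h2⟩)
    have hy : p.2 ^ 2 ≤ π ^ 2 := sq_le_sq.2 (by
      rw [abs_of_pos pi_pos]; exact abs_le.2 ⟨h3.le, h4⟩)
    have : s ≤ 8 / (15 * π ^ 2) * (π ^ 2 + π ^ 2) := by
      rw [hs]
      gcongr
    refine this.trans (le_of_eq ?_)
    field_simp
    norm_num
  have hB : 1 / 3 + s ≤ ‖rookDenom p‖ := (le_re_rookDenom hp).trans (Complex.re_le_norm _)
  have hexp : -(4 / (15 * π ^ 2) * (p.1 ^ 2 + p.2 ^ 2)) = -(s / 2) := by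
    rw [hs]
    ring
  calc ‖rookKernel p‖ = ‖1 + (rookDenom p)⁻¹‖ / 4 := by
        simp [rookKernel, norm_diagCharacter]
    _ ≤ (1 + (1 / 3 + s)⁻¹) / 4 := by
        gcongr
        refine (norm_add_le _ _).trans ?_
        rw [norm_one, norm_inv]
        gcongr
    _ ≤ 1 - s / 2 := by
        have : (1 / 3 + s)⁻¹ ≤ 3 - 2 * s := by
          rw [inv_le_iff_one_le_mul₀ (by positivity)]
          nlinarith
        linarith
    _ ≤ _ := by
        rw [hexp]
        linarith [add_one_le_exp (-(s / 2))]

theorem norm_rookAmplitude_le {p : ℝ × ℝ} (hp : p ∈ angleSquare) : ‖rookAmplitude p‖ ≤ 3 := by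
  have h := third_le_re_rookDenom hp
  have h1 : 1 / 3 ≤ ‖rookDenom p‖ := h.trans (Complex.re_le_norm _)
  have h2 : 1 ≤ ‖1 + rookDenom p‖ := by
    refine le_trans ?_ (Complex.re_le_norm _)
    simp
    linarith
  rw [rookAmplitude, norm_mul, norm_inv, norm_inv]
  calc ‖rookDenom p‖⁻¹ * ‖1 + rookDenom p‖⁻¹ ≤ (1 / 3)⁻¹ * 1⁻¹ := by gcongr
    _ = 3 := by norm_num

theorem rookWalkCount_eq_setIntegral_rookKernel {n : ℕ} (hn : n ≠ 0) :
    (rookWalkCount 3 (fun _ => n) : ℂ) * (2 * π) ^ 2 / 64 ^ n =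
      ∫ p in angleSquare, rookKernel p ^ n * rookAmplitude p := by
  have key : ∀ p ∈ angleSquare, diagCharacter p ^ n *
      ∑' L, rookLevelTerm (quarterCircle p.1) (quarterCircle p.2) n L =
      4 ^ n * (rookKernel p ^ n * rookAmplitude p) := by
    intro p hp
    obtain ⟨m, rfl⟩ := Nat.exists_eq_succ_of_ne_zero hn
    have hre := third_le_re_rookDenom hp
    have hB0 : rookDenom p ≠ 0 := by
      intro h
      norm_num [h] at hre
    have hB1 : 1 + rookDenom p ≠ 0 := by
      intro h
      have := congrArg Complex.re h
      simp at this
      linarith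
    rw [Nat.succ_eq_add_one, tsum_rookLevelTerm_succ (norm_quarterCircle _) (norm_quarterCircle _)
      rfl hB0, rookKernel, rookAmplitude, div_pow, mul_pow, pow_succ (1 + (rookDenom p)⁻¹)]
    change _ * ((1 + (rookDenom p)⁻¹) ^ m * (rookDenom p)⁻¹ ^ 2) = _
    have h4 : (4 : ℂ) ^ (m + 1) ≠ 0 := pow_ne_zero _ (by norm_num)
    have hrw : (1 + (rookDenom p)⁻¹) * ((rookDenom p)⁻¹ * (1 + rookDenom p)⁻¹)
        = (rookDenom p)⁻¹ ^ 2 := by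
      field_simp
      ring
    rw [← hrw]
    field_simp
  have h := rookWalkCount_eq_setIntegral n
  rw [setIntegral_congr_fun measurableSet_angleSquare key, integral_const_mul] at h
  have h64 : (64 : ℂ) ^ n = 4 ^ n * 4 ^ (n + n) := by
    rw [← pow_add, show (64 : ℂ) = 4 ^ 3 by norm_num, ← pow_mul]
    congr 1
    ring
  have h4 : (4 : ℂ) ^ n ≠ 0 := pow_ne_zero _ (by norm_num)
  rw [← mul_right_inj' h4, ← h, h64]
  rw [one_div, inv_pow]
  field_simp

theorem tendsto_inv_sqrt_natCast : Tendsto (fun n : ℕ => (√(n : ℝ))⁻¹) atTop (𝓝 0) :=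
  tendsto_inv_atTop_zero.comp (tendsto_sqrt_atTop.comp tendsto_natCast_atTop_atTop)

theorem tendsto_sqrt_mul_exp_sub_one (u : ℝ) :
    Tendsto (fun n : ℕ => (√(n : ℝ) : ℂ) *
      (Complex.exp (((√(n : ℝ))⁻¹ * u : ℝ) * Complex.I) - 1)) atTop (𝓝 (u * Complex.I)) := by
  have hderiv : HasDerivAt (fun t : ℝ => Complex.exp ((t * u : ℝ) * Complex.I))
      (u * Complex.I) 0 := by
    have h1 : HasDerivAt (fun t : ℝ => ((t * u : ℝ) : ℂ) * Complex.I) (u * Complex.I) 0 := by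
      have := ((hasDerivAt_id (0 : ℝ)).mul_const u).ofReal_comp.mul_const Complex.I
      simpa using this
    simpa using h1.cexp
  have hslope := hasDerivAt_iff_tendsto_slope_zero.1 hderiv
  have hlim : Tendsto (fun n : ℕ => (√(n : ℝ))⁻¹) atTop (𝓝[≠] 0) := by
    refine tendsto_nhdsWithin_iff.2 ⟨tendsto_inv_sqrt_natCast, ?_⟩
    filter_upwards [eventually_gt_atTop 0] with n hn
    have : (0 : ℝ) < n := by exact_mod_cast hn
    exact (inv_pos.2 (sqrt_pos.2 this)).ne'
  refine (hslope.comp hlim).congr fun n => ?_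
  simp

/-- The kernel as a rational function of `exp (i θ₁)` and `exp (i θ₂)`, expanded around `1`. -/
theorem rookKernel_sub_one {p : ℝ × ℝ} (hp : p ∈ angleSquare) {a b : ℂ}
    (ha : a = Complex.exp (p.1 * Complex.I) - 1) (hb : b = Complex.exp (p.2 * Complex.I) - 1) :
    rookKernel p - 1 =
      (5 * (a ^ 2 + a * b + b ^ 2) + (2 * a ^ 2 * b + 2 * b ^ 2 * a - 3 * a ^ 2 * b ^ 2)) /
        ((1 + a) * (1 + b) * (3 - 5 * a - 5 * b + 3 * a * b)) := by
  have hea : Complex.exp (p.1 * Complex.I) = 1 + a := by rw [ha]; ring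
  have heb : Complex.exp (p.2 * Complex.I) = 1 + b := by rw [hb]; ring
  have ha0 : 1 + a ≠ 0 := hea ▸ Complex.exp_ne_zero _
  have hb0 : 1 + b ≠ 0 := heb ▸ Complex.exp_ne_zero _
  have hx := one_sub_quarterCircle_ne_zero p.1
  have hy := one_sub_quarterCircle_ne_zero p.2
  have hre := third_le_re_rookDenom hp
  have hB0 : rookDenom p ≠ 0 := by
    intro h
    norm_num [h] at hre
  rw [quarterCircle, hea] at hx
  rw [quarterCircle, heb] at hy
  have hx' : 3 - a ≠ 0 := by
    intro h
    exact hx (by linear_combination h / 4)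
  have hy' : 3 - b ≠ 0 := by
    intro h
    exact hy (by linear_combination h / 4)
  have hBval : rookDenom p = (3 - 5 * a - 5 * b + 3 * a * b) / ((3 - a) * (3 - b)) := by
    rw [rookDenom, quarterCircle, quarterCircle, hea, heb,
      show 1 - (1 + a) / 4 = (3 - a) / 4 by ring, show 1 - (1 + b) / 4 = (3 - b) / 4 by ring]
    field_simp
    ring
  have hP : 3 - 5 * a - 5 * b + 3 * a * b ≠ 0 := by
    intro h
    exact hB0 (by rw [hBval, h, zero_div])
  rw [rookKernel, diagCharacter, Complex.exp_neg, Complex.exp_neg, hea, heb, hBval]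
  obtain ⟨P, hPdef⟩ : ∃ P, P = 3 - 5 * a - 5 * b + 3 * a * b := ⟨_, rfl⟩
  rw [← hPdef] at hP ⊢
  field_simp
  rw [hPdef]
  ring

theorem tendsto_rookKernel_pow (u : ℝ × ℝ)
    (hmem : ∀ᶠ n : ℕ in atTop, (√(n : ℝ))⁻¹ • u ∈ angleSquare) :
    Tendsto (fun n : ℕ => rookKernel ((√(n : ℝ))⁻¹ • u) ^ n) atTop
      (𝓝 (Complex.exp (-(5 / 3 * (u.1 ^ 2 + u.1 * u.2 + u.2 ^ 2))))) := by
  set a : ℕ → ℂ := fun n => Complex.exp (((√(n : ℝ))⁻¹ * u.1 : ℝ) * Complex.I) - 1 with ha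
  set b : ℕ → ℂ := fun n => Complex.exp (((√(n : ℝ))⁻¹ * u.2 : ℝ) * Complex.I) - 1 with hb
  have hA : Tendsto (fun n : ℕ => (√(n : ℝ) : ℂ) * a n) atTop (𝓝 (u.1 * Complex.I)) :=
    tendsto_sqrt_mul_exp_sub_one u.1
  have hB : Tendsto (fun n : ℕ => (√(n : ℝ) : ℂ) * b n) atTop (𝓝 (u.2 * Complex.I)) :=
    tendsto_sqrt_mul_exp_sub_one u.2
  have hzero : ∀ v : ℝ, Tendsto
      (fun n : ℕ => Complex.exp (((√(n : ℝ))⁻¹ * v : ℝ) * Complex.I) - 1) atTop (𝓝 0) := by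
    intro v
    have hc : Continuous fun t : ℝ => Complex.exp ((t * v : ℝ) * Complex.I) - 1 := by fun_prop
    have h := (hc.tendsto 0).comp tendsto_inv_sqrt_natCast
    rwa [zero_mul, Complex.ofReal_zero, zero_mul, Complex.exp_zero, sub_self] at h
  have ha0 : Tendsto a atTop (𝓝 0) := hzero u.1
  have hb0 : Tendsto b atTop (𝓝 0) := hzero u.2
  have hmain : Tendsto (fun n : ℕ => (n : ℂ) * (rookKernel ((√(n : ℝ))⁻¹ • u) - 1)) atTop
      (𝓝 (-(5 / 3 * (u.1 ^ 2 + u.1 * u.2 + u.2 ^ 2)))) := by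
    have hnum := ((((hA.pow 2).add (hA.mul hB)).add (hB.pow 2)).const_mul 5).add
      (((((hA.pow 2).mul hb0).const_mul 2).add (((hB.pow 2).mul ha0).const_mul 2)).sub
        (((hA.pow 2).mul (hb0.pow 2)).const_mul 3))
    have hden := ((ha0.const_add 1).mul (hb0.const_add 1)).mul
      ((((ha0.const_mul 5).const_sub 3).sub (hb0.const_mul 5)).add ((ha0.mul hb0).const_mul 3))
    have hq := hnum.div hden (by norm_num)
    have hlim : -(5 / 3 * ((u.1 : ℂ) ^ 2 + u.1 * u.2 + u.2 ^ 2)) =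
        (5 * ((u.1 * Complex.I) ^ 2 + u.1 * Complex.I * (u.2 * Complex.I) + (u.2 * Complex.I) ^ 2)
          + (2 * ((u.1 * Complex.I) ^ 2 * 0) + 2 * ((u.2 * Complex.I) ^ 2 * 0)
            - 3 * ((u.1 * Complex.I) ^ 2 * 0 ^ 2))) /
        ((1 + 0) * (1 + 0) * (3 - 5 * 0 - 5 * 0 + 3 * (0 * 0))) := by
      ring_nf
      rw [Complex.I_sq]
      ring
    rw [hlim]
    refine hq.congr' ?_
    filter_upwards [hmem] with n hn
    rw [rookKernel_sub_one hn (a := a n) (b := b n) rfl rfl]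
    have hsq : (n : ℂ) = (√(n : ℝ) : ℂ) ^ 2 := by
      rw [← Complex.ofReal_pow, sq_sqrt (Nat.cast_nonneg n), Complex.ofReal_natCast]
    simp only [Pi.div_apply]
    rw [← mul_div_assoc, hsq]
    congr 1 <;> ring
  simpa using Complex.tendsto_one_add_pow_exp_of_tendsto hmain

theorem tendsto_rookAmplitude (u : ℝ × ℝ) :
    Tendsto (fun n : ℕ => rookAmplitude ((√(n : ℝ))⁻¹ • u)) atTop (𝓝 (9 / 4)) := by
  have hzero : Tendsto (fun n : ℕ => (√(n : ℝ))⁻¹ • u) atTop (𝓝 0) := by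
    simpa using tendsto_inv_sqrt_natCast.smul_const u
  have hB0 : rookDenom 0 = 1 / 3 := by
    norm_num [rookDenom, quarterCircle]
  have hB : Tendsto (fun n : ℕ => rookDenom ((√(n : ℝ))⁻¹ • u)) atTop (𝓝 (1 / 3)) :=
    hB0 ▸ (continuous_rookDenom.tendsto 0).comp hzero
  have h := (hB.inv₀ (by norm_num)).mul ((hB.const_add 1).inv₀ (by norm_num))
  have hval : ((1 : ℂ) / 3)⁻¹ * (1 + 1 / 3)⁻¹ = 9 / 4 := by norm_num
  rwa [hval] at h

theorem eventually_inv_sqrt_smul_mem_angleSquare (u : ℝ × ℝ) :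
    ∀ᶠ n : ℕ in atTop, (√(n : ℝ))⁻¹ • u ∈ angleSquare := by
  have hzero : Tendsto (fun n : ℕ => (√(n : ℝ))⁻¹ • u) atTop (𝓝 0) := by
    simpa using tendsto_inv_sqrt_natCast.smul_const u
  refine hzero.eventually_mem (prod_mem_nhds ?_ ?_) <;>
    exact Ioc_mem_nhds (by simp [pi_pos]) pi_pos

theorem measurable_rookKernel : Measurable rookKernel := by
  have h1 := continuous_rookDenom.measurable
  have h2 := continuous_diagCharacter.measurable
  unfold rookKernel
  fun_prop

theorem measurable_rookAmplitude : Measurable rookAmplitude := by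
  have h1 := continuous_rookDenom.measurable
  unfold rookAmplitude
  fun_prop

theorem integrable_exp_neg_mul_sq_add_sq {c : ℝ} (hc : 0 < c) :
    Integrable fun u : ℝ × ℝ => exp (-(c * (u.1 ^ 2 + u.2 ^ 2))) := by
  refine ((integrable_exp_neg_mul_sq hc).mul_prod (integrable_exp_neg_mul_sq hc)).congr
    (ae_of_all _ fun u => ?_)
  simp only [← exp_add]
  congr 1
  ring

theorem integral_exp_neg_quadratic :
    ∫ u : ℝ × ℝ, exp (-(5 / 3 * (u.1 ^ 2 + u.1 * u.2 + u.2 ^ 2))) = 2 * √3 * π / 5 := by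
  have hint : Integrable fun u : ℝ × ℝ =>
      exp (-(5 / 3 * (u.1 ^ 2 + u.1 * u.2 + u.2 ^ 2))) := by
    refine (integrable_exp_neg_mul_sq_add_sq (c := 5 / 6) (by norm_num)).mono'
      (by fun_prop) (ae_of_all _ fun u => ?_)
    rw [norm_of_nonneg (exp_pos _).le]
    refine exp_le_exp.2 ?_
    nlinarith [sq_nonneg (u.1 + u.2)]
  have hinner : ∀ x : ℝ, ∫ y : ℝ, exp (-(5 / 3 * (x ^ 2 + x * y + y ^ 2))) =
      exp (-(5 / 4) * x ^ 2) * √(π / (5 / 3)) := by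
    intro x
    have h := integral_add_right_eq_self (μ := volume)
      (fun y : ℝ => exp (-(5 / 3) * y ^ 2)) (x / 2)
    rw [integral_gaussian] at h
    rw [← h, ← integral_const_mul]
    congr 1
    ext y
    rw [← exp_add]
    congr 1
    ring
  rw [Measure.volume_eq_prod] at hint ⊢
  rw [integral_prod _ hint]
  simp only [hinner]
  rw [integral_mul_const, integral_gaussian, ← sqrt_mul (by positivity),
    sqrt_eq_iff_mul_self_eq (by positivity) (by positivity)]
  have h3 : √3 * √3 = (3 : ℝ) := mul_self_sqrt (by norm_num)
  linear_combination (-4 * π ^ 2 / 25) * h3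

theorem tendsto_mul_setIntegral_rookKernel :
    Tendsto (fun n : ℕ => (n : ℂ) * ∫ p in angleSquare, rookKernel p ^ n * rookAmplitude p)
      atTop (𝓝 (9 / 4 * (2 * √3 * π / 5 : ℝ))) := by
  set f : ℕ → ℝ × ℝ → ℂ := fun n =>
    angleSquare.indicator fun p => rookKernel p ^ n * rookAmplitude p with hf
  set c : ℝ := 4 / (15 * π ^ 2) with hc
  have hc0 : 0 < c := by positivity
  have hscale : ∀ᶠ n : ℕ in atTop, ∫ u : ℝ × ℝ, f n ((√(n : ℝ))⁻¹ • u) =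
      (n : ℂ) * ∫ p in angleSquare, rookKernel p ^ n * rookAmplitude p := by
    filter_upwards with n
    rw [Measure.integral_comp_smul, hf, integral_indicator measurableSet_angleSquare]
    simp [abs_of_nonneg]
  refine Tendsto.congr' hscale ?_
  have hlimit : ∫ u : ℝ × ℝ,
      Complex.exp (-(5 / 3 * (u.1 ^ 2 + u.1 * u.2 + u.2 ^ 2))) * (9 / 4) =
      9 / 4 * (2 * √3 * π / 5 : ℝ) := by
    rw [integral_mul_const, ← integral_exp_neg_quadratic, ← integral_complex_ofReal, mul_comm]
    push_cast
    rfl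
  rw [← hlimit]
  refine tendsto_integral_filter_of_dominated_convergence
    (fun u => exp (-(c * (u.1 ^ 2 + u.2 ^ 2))) * 3) ?_ ?_
    ((integrable_exp_neg_mul_sq_add_sq hc0).mul_const 3) ?_
  · refine Eventually.of_forall fun n => ?_
    have hmeas : Measurable (f n) :=
      ((measurable_rookKernel.pow_const n).mul measurable_rookAmplitude).indicator
        measurableSet_angleSquare
    exact (hmeas.comp (measurable_const_smul _)).aestronglyMeasurable
  · filter_upwards [eventually_gt_atTop 0] with n hn
    refine ae_of_all _ fun u => ?_
    rw [hf]
    by_cases hu : (√(n : ℝ))⁻¹ • u ∈ angleSquare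
    · simp only [Set.indicator_of_mem hu, norm_mul, norm_pow]
      refine mul_le_mul ?_ (norm_rookAmplitude_le hu) (norm_nonneg _) (exp_pos _).le
      refine (pow_le_pow_left₀ (norm_nonneg _) (norm_rookKernel_le hu) n).trans (le_of_eq ?_)
      rw [← exp_nat_mul]
      congr 1
      have hn' : (0 : ℝ) < n := by exact_mod_cast hn
      simp only [Prod.smul_fst, Prod.smul_snd, smul_eq_mul, mul_pow, inv_pow,
        sq_sqrt hn'.le, hc]
      field_simp
    · simp only [Set.indicator_of_notMem hu, norm_zero]
      positivity
  · refine ae_of_all _ fun u => ?_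
    have hmem := eventually_inv_sqrt_smul_mem_angleSquare u
    refine ((tendsto_rookKernel_pow u hmem).mul (tendsto_rookAmplitude u)).congr' ?_
    filter_upwards [hmem] with n hn
    rw [hf]
    simp only [Set.indicator_of_mem hn]

end Asymptotics

/-- Asymptotics of diagonal 3-dimensional rook walk numbers:
`aₙ ~ (9√3/(40πn)) · 64ⁿ` as `n → ∞`. -/
theorem rook_diag_asymptotics_three_dim :
    Filter.Tendsto
      (fun n : ℕ =>
        (rookWalkCount 3 (fun _ => n) : ℝ) /
          ((9 * Real.sqrt 3 / (40 * Real.pi * n)) * (64 : ℝ) ^ n))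
      Filter.atTop (nhds 1) := by
  have hπ : (π : ℂ) ≠ 0 := by exact_mod_cast pi_ne_zero
  have h3 : ((√3 : ℝ) : ℂ) ≠ 0 := by
    exact_mod_cast (sqrt_pos.2 (by norm_num : (0 : ℝ) < 3)).ne'
  have h := tendsto_mul_setIntegral_rookKernel.mul_const
    (40 * (π : ℂ) / (9 * (√3 : ℝ) * (2 * π) ^ 2))
  have hone : 9 / 4 * ((2 * √3 * π / 5 : ℝ) : ℂ) * (40 * (π : ℂ) / (9 * (√3 : ℝ) * (2 * π) ^ 2))
      = 1 := by
    push_cast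
    field_simp
    norm_num
  rw [hone] at h
  have hre := (Complex.continuous_re.tendsto 1).comp h
  rw [Complex.one_re] at hre
  refine hre.congr' ?_
  filter_upwards [eventually_ne_atTop 0] with n hn
  have hn' : (n : ℂ) ≠ 0 := by exact_mod_cast hn
  rw [Function.comp_apply, ← rookWalkCount_eq_setIntegral_rookKernel hn,
    ← Complex.ofReal_re ((rookWalkCount 3 (fun _ => n) : ℝ) / _)]
  congr 1
  push_cast
  field_simp
end

section
/- For every d ≥ 1, the diagonal sequence of d-dimensional rook walk numbers satisfies a nontrivial linear recurrence with polynomial coefficients: there exist r ∈ ℕ and polynomials p_0, p_1, …, p_r with rational coefficients, not all zero, such that ∑_{i=0}^{r} p_i(n) · a_d(n+i, n+i, …, n+i) = 0 for all n ≥ 0. -/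
open Finset

open Polynomial

/-- The linear functional `x ^ m ↦ m!` on polynomials, that is `p ↦ ∫₀^∞ p(x) e⁻ˣ dx`. -/
noncomputable def factorialFunctional : ℚ[X] →ₗ[ℚ] ℚ :=
  Polynomial.lsum fun m => (m.factorial : ℚ) • LinearMap.id

theorem factorialFunctional_monomial (m : ℕ) (c : ℚ) :
    factorialFunctional (monomial m c) = m.factorial * c := by
  simp [factorialFunctional, Polynomial.lsum_apply, Polynomial.sum_monomial_index]

theorem factorialFunctional_C_mul (c : ℚ) (p : ℚ[X]) :
    factorialFunctional (C c * p) = c * factorialFunctional p := by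
  rw [← smul_eq_C_mul, map_smul, smul_eq_mul]

theorem factorialFunctional_derivative (p : ℚ[X]) :
    factorialFunctional (derivative p) = factorialFunctional p - p.eval 0 := by
  induction p using Polynomial.induction_on' with
  | add p q hp hq => simp only [map_add, eval_add, hp, hq]; ring
  | monomial m c =>
    rw [derivative_monomial, factorialFunctional_monomial, factorialFunctional_monomial]
    cases m with
    | zero => simp
    | succ m => simp [Nat.factorial_succ]; ring

/-- The polynomials `∑ₖ (n - 1).choose (k - 1) xᵏ / k!`, with generating function
`∑ₙ gₙ(x) zⁿ = exp (x z / (1 - z))`; they are the Laguerre polynomials `Lₙ^(-1)(-x)`. -/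
noncomputable def laguerreNeg : ℕ → ℚ[X]
  | 0 => 1
  | n + 1 => C ((n + 1 : ℚ)⁻¹) *
      ((C (n : ℚ) + X) * laguerreNeg n + X * derivative (laguerreNeg n))

theorem C_mul_laguerreNeg_succ (n : ℕ) :
    C (n + 1 : ℚ) * laguerreNeg (n + 1) =
      (C (n : ℚ) + X) * laguerreNeg n + X * derivative (laguerreNeg n) := by
  have h : (n + 1 : ℚ) ≠ 0 := by positivity
  rw [laguerreNeg, ← mul_assoc, ← C_mul, mul_inv_cancel₀ h, C_1, one_mul]

theorem derivative_laguerreNeg_succ_of_ode {n : ℕ}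
    (h : X * (derivative (derivative (laguerreNeg n)) + derivative (laguerreNeg n)) =
      C (n : ℚ) * laguerreNeg n) :
    derivative (laguerreNeg (n + 1)) = laguerreNeg n + derivative (laguerreNeg n) := by
  have hn : C (n + 1 : ℚ) ≠ 0 := C_ne_zero.mpr (by positivity)
  apply mul_left_cancel₀ hn
  have h1 := congrArg derivative (C_mul_laguerreNeg_succ n)
  simp only [derivative_mul, derivative_add, derivative_C, derivative_X] at h1
  simp only [C_add, C_1] at *
  linear_combination h1 + h

theorem laguerreNeg_ode (n : ℕ) :
    X * (derivative (derivative (laguerreNeg n)) + derivative (laguerreNeg n)) =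
      C (n : ℚ) * laguerreNeg n := by
  induction n with
  | zero => simp [laguerreNeg]
  | succ n ih =>
    rw [derivative_laguerreNeg_succ_of_ode ih, Nat.cast_succ, C_mul_laguerreNeg_succ,
      derivative_add]
    linear_combination ih

theorem derivative_laguerreNeg_succ (n : ℕ) :
    derivative (laguerreNeg (n + 1)) = laguerreNeg n + derivative (laguerreNeg n) :=
  derivative_laguerreNeg_succ_of_ode (laguerreNeg_ode n)

theorem derivative_laguerreNeg (n : ℕ) :
    derivative (laguerreNeg n) = ∑ m ∈ range n, laguerreNeg m := by
  induction n with
  | zero => simp [laguerreNeg]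
  | succ n ih => rw [derivative_laguerreNeg_succ, sum_range_succ, ih, add_comm]

theorem eval_zero_laguerreNeg {n : ℕ} (hn : n ≠ 0) : (laguerreNeg n).eval 0 = 0 := by
  obtain ⟨n, rfl⟩ := Nat.exists_eq_succ_of_ne_zero hn
  induction n with
  | zero => simp [laguerreNeg]
  | succ n ih =>
    rw [laguerreNeg]
    simp [ih]

/-! ### Counting rook walks -/

theorem factorialFunctional_prod_laguerreNeg {d : ℕ} {v : Fin d → ℕ} (hv : v ≠ 0) :
    factorialFunctional (∏ i, laguerreNeg (v i)) =
      ∑ p ∈ univ.sigma fun i => range (v i),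
        factorialFunctional (∏ j, laguerreNeg (Function.update v p.1 p.2 j)) := by
  obtain ⟨i₀, hi₀⟩ := Function.ne_iff.mp hv
  have h0 : (∏ i, laguerreNeg (v i)).eval 0 = 0 := by
    rw [eval_prod]
    exact prod_eq_zero (mem_univ i₀) (eval_zero_laguerreNeg hi₀)
  rw [← sub_zero (factorialFunctional _), ← h0, ← factorialFunctional_derivative,
    derivative_prod_finset, map_sum, sum_sigma]
  refine sum_congr rfl fun i _ => ?_
  rw [derivative_laguerreNeg, mul_sum, map_sum]
  refine sum_congr rfl fun m _ => ?_
  congr 1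
  rw [← prod_erase_mul univ _ (mem_univ i)]
  congr 1
  · refine prod_congr rfl fun j hj => ?_
    rw [Function.update_of_ne (ne_of_mem_erase hj)]
  · simp

theorem nil_mem_rookWalks_iff {d : ℕ} {v : Fin d → ℕ} : [] ∈ RookWalks d v ↔ v = 0 := by
  simp only [RookWalks, Set.mem_ofPred_eq, List.map_nil, List.sum_nil, funext_iff, Pi.zero_apply]
  simp [eq_comm]

theorem cons_mem_rookWalks_iff {d : ℕ} {v : Fin d → ℕ} {i : Fin d} {s : ℕ}
    {w : List (Fin d × ℕ)} :
    (i, s) :: w ∈ RookWalks d v ↔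
      0 < s ∧ s ≤ v i ∧ w ∈ RookWalks d (Function.update v i (v i - s)) := by
  simp only [RookWalks, Set.mem_ofPred_eq, List.mem_cons, forall_eq_or_imp, List.map_cons,
    List.sum_cons]
  constructor
  · rintro ⟨⟨hs, hw⟩, h⟩
    have hi := h i
    rw [if_pos rfl] at hi
    refine ⟨hs, by omega, hw, fun j => ?_⟩
    rcases eq_or_ne j i with rfl | hj
    · rw [Function.update_self]; omega
    · have := h j
      rw [if_neg hj.symm] at this
      rw [Function.update_of_ne hj]; omega
  · rintro ⟨hs, hle, hw, h⟩
    refine ⟨⟨hs, hw⟩, fun j => ?_⟩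
    have := h j
    rcases eq_or_ne j i with rfl | hj
    · rw [Function.update_self] at this
      rw [if_pos rfl]; omega
    · rw [Function.update_of_ne hj] at this
      rw [if_neg hj.symm]; omega

theorem exists_finset_rookWalks {d : ℕ} (v : Fin d → ℕ) :
    ∃ F : Finset (List (Fin d × ℕ)), (F : Set _) = RookWalks d v ∧
      (F.card : ℚ) = factorialFunctional (∏ i, laguerreNeg (v i)) := by
  induction hN : ∑ i, v i using Nat.strong_induction_on generalizing v with
  | _ N ih =>
  rcases eq_or_ne v 0 with rfl | hv
  · refine ⟨{[]}, ?_, ?_⟩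
    · ext w
      rcases w with _ | ⟨⟨i, s⟩, w⟩
      · simp [nil_mem_rookWalks_iff]
      · simp only [cons_mem_rookWalks_iff, coe_singleton, Set.mem_singleton_iff, Pi.zero_apply]
        simp; omega
    · have := factorialFunctional_monomial 0 1
      simp only [monomial_zero_left, C_1] at this
      simp [laguerreNeg, this]
  · have key : ∀ p : Sigma fun _ : Fin d => ℕ, p ∈ univ.sigma (fun i => range (v i)) →
        ∃ F : Finset (List (Fin d × ℕ)), (F : Set _) = RookWalks d (Function.update v p.1 p.2) ∧
          (F.card : ℚ) =
            factorialFunctional (∏ j, laguerreNeg (Function.update v p.1 p.2 j)) := by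
      rintro ⟨i, m⟩ hp
      simp only [mem_sigma, mem_univ, true_and, mem_range] at hp
      refine ih _ ?_ _ rfl
      rw [← hN]
      refine sum_lt_sum (fun j _ => ?_) ⟨i, mem_univ i, by simpa using hp⟩
      rcases eq_or_ne j i with rfl | hj
      · simpa using hp.le
      · simp [hj]
    choose! F hF hcard using key
    classical
    refine ⟨(univ.sigma fun i => range (v i)).biUnion fun p =>
      (F p).image (List.cons (p.1, v p.1 - p.2)), ?_, ?_⟩
    · ext w
      simp only [coe_biUnion, coe_image, Set.mem_iUnion, mem_coe, exists_prop]
      constructor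
      · rintro ⟨⟨i, m⟩, hp, w, hw, rfl⟩
        rw [hF _ hp] at hw
        simp only [mem_sigma, mem_univ, true_and, mem_range] at hp
        rw [cons_mem_rookWalks_iff]
        refine ⟨Nat.sub_pos_of_lt hp, Nat.sub_le _ _, ?_⟩
        rwa [Nat.sub_sub_self hp.le]
      · intro hw
        rcases w with _ | ⟨⟨i, s⟩, w⟩
        · exact absurd (nil_mem_rookWalks_iff.mp hw) hv
        · obtain ⟨hs, hle, hw⟩ := cons_mem_rookWalks_iff.mp hw
          have hp : (⟨i, v i - s⟩ : Sigma fun _ : Fin d => ℕ) ∈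
              univ.sigma (fun i => range (v i)) := by
            simp only [mem_sigma, mem_univ, true_and, mem_range]; omega
          refine ⟨⟨i, v i - s⟩, hp, w, ?_, ?_⟩
          · rwa [hF _ hp]
          · simp [Nat.sub_sub_self hle]
    · rw [card_biUnion, Nat.cast_sum, factorialFunctional_prod_laguerreNeg hv]
      · refine sum_congr rfl fun p hp => ?_
        rw [card_image_of_injective _ (List.cons_injective), hcard p hp]
      · rintro ⟨i, m⟩ hp ⟨j, l⟩ hq hpq
        simp only [mem_coe, mem_sigma, mem_univ, true_and, mem_range] at hp hq
        rw [Function.onFun, disjoint_left]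
        rintro w hw hw'
        obtain ⟨w₁, -, rfl⟩ := mem_image.mp hw
        obtain ⟨w₂, -, h⟩ := mem_image.mp hw'
        simp only [List.cons.injEq, Prod.mk.injEq] at h
        obtain ⟨⟨rfl, h⟩, -⟩ := h
        exact hpq (by congr 1; omega)

theorem rookWalkCount_eq_factorialFunctional {d : ℕ} (v : Fin d → ℕ) :
    (rookWalkCount d v : ℚ) = factorialFunctional (∏ i, laguerreNeg (v i)) := by
  obtain ⟨F, hF, hcard⟩ := exists_finset_rookWalks v
  rw [rookWalkCount, ← hF, Set.ncard_coe_finset, hcard]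

/-! ### Sequences spanned by finitely many sequences over the polynomials in the index -/

/-- The sequence `f` is a combination of the sequences `s j` with coefficients polynomial in the
index. -/
def IsPolyComb {k : ℕ} (s : Fin k → ℕ → ℚ) (f : ℕ → ℚ) : Prop :=
  ∃ c : Fin k → ℚ[X], ∀ n : ℕ, f n = ∑ j, (c j).eval (n : ℚ) * s j n

namespace IsPolyComb

variable {k : ℕ} {s : Fin k → ℕ → ℚ} {f g : ℕ → ℚ}

theorem zero : IsPolyComb s fun _ => 0 := ⟨0, by simp⟩

theorem basis (j : Fin k) : IsPolyComb s (s j) := by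
  refine ⟨Pi.single j 1, fun n => ?_⟩
  rw [sum_eq_single j]
  · simp
  · intro i _ hi
    simp [hi]
  · simp

theorem add (hf : IsPolyComb s f) (hg : IsPolyComb s g) : IsPolyComb s fun n => f n + g n := by
  obtain ⟨c, hc⟩ := hf
  obtain ⟨e, he⟩ := hg
  exact ⟨c + e, fun n => by simp [hc, he, add_mul, sum_add_distrib]⟩

theorem poly_mul (p : ℚ[X]) (hf : IsPolyComb s f) :
    IsPolyComb s fun n => p.eval (n : ℚ) * f n := by
  obtain ⟨c, hc⟩ := hf
  exact ⟨fun j => p * c j, fun n => by simp [hc, mul_sum, mul_assoc]⟩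

theorem const_mul (a : ℚ) (hf : IsPolyComb s f) : IsPolyComb s fun n => a * f n := by
  simpa using hf.poly_mul (C a)

theorem index_mul (hf : IsPolyComb s f) : IsPolyComb s fun n => n * f n := by
  simpa using hf.poly_mul X

theorem sum {ι : Type*} {t : Finset ι} {f : ι → ℕ → ℚ} (h : ∀ i ∈ t, IsPolyComb s (f i)) :
    IsPolyComb s fun n => ∑ i ∈ t, f i n := by
  classical
  induction t using Finset.induction_on with
  | empty => simpa using zero
  | insert a t ha ih =>
    simp only [sum_insert ha]
    exact (h a (mem_insert_self _ _)).add (ih fun i hi => h i (mem_insert_of_mem hi))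

/-- If the shifts of the spanning sequences are spanned up to the factor `q`, then so is the shift
of every spanned sequence. -/
theorem shift {q : ℚ[X]}
    (hs : ∀ j, IsPolyComb s fun n => q.eval (n : ℚ) * s j (n + 1)) (hf : IsPolyComb s f) :
    IsPolyComb s fun n => q.eval (n : ℚ) * f (n + 1) := by
  obtain ⟨c, hc⟩ := hf
  have := sum (t := univ) fun j _ => (hs j).poly_mul ((c j).comp (X + 1))
  convert this using 2 with n
  rw [hc, mul_sum]
  refine sum_congr rfl fun j _ => ?_
  simp only [eval_comp, eval_add, eval_X, eval_one, Nat.cast_add, Nat.cast_one]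
  ring

/-- A sequence all of whose shifts are spanned, up to nonzero polynomial factors, by a fixed finite
family of sequences satisfies a linear recurrence with polynomial coefficients. -/
theorem exists_recurrence
    (h : ∀ b : ℕ, ∃ D : ℚ[X], D ≠ 0 ∧ IsPolyComb s fun n => D.eval (n : ℚ) * f (n + b)) :
    ∃ p : ℕ → ℚ[X], (∃ i ≤ k, p i ≠ 0) ∧
      ∀ n : ℕ, ∑ i ∈ range (k + 1), (p i).eval (n : ℚ) * f (n + i) = 0 := by
  choose D hD c hc using h
  have hdep : ¬ LinearIndependent ℚ[X] fun b : Fin (k + 1) => c b := by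
    intro hli
    have := hli.fintype_card_le_finrank
    simp at this
  obtain ⟨q, hq, b, hb⟩ := Fintype.not_linearIndependent_iff.mp hdep
  have hq' (n : ℕ) : ∑ b : Fin (k + 1), (q b * D b).eval (n : ℚ) * f (n + b) = 0 := by
    simp only [eval_mul, mul_assoc, hc, mul_sum]
    rw [sum_comm]
    refine sum_eq_zero fun j _ => ?_
    have := congrArg (eval (n : ℚ)) (congrFun hq j)
    simp only [Finset.sum_apply, Pi.smul_apply, smul_eq_mul, Pi.zero_apply, eval_zero,
      eval_finsetSum, eval_mul] at this
    simp only [← mul_assoc]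
    rw [← sum_mul, this, zero_mul]
  refine ⟨fun i => if hi : i < k + 1 then q ⟨i, hi⟩ * D i else 0,
    ⟨b, Nat.lt_succ_iff.mp b.2, ?_⟩, fun n => ?_⟩
  · beta_reduce
    rw [dif_pos b.2]
    exact mul_ne_zero hb (hD b)
  · rw [sum_range, ← hq' n]
    refine sum_congr rfl fun i _ => ?_
    beta_reduce
    rw [dif_pos i.2]

end IsPolyComb

/-! ### The moments of products of `laguerreNeg n` and its derivative -/

/-- The functional applied to `(laguerreNeg n) ^ j * (laguerreNeg n)' ^ (d - j)`. -/
noncomputable def laguerreMoment (d : ℕ) (j : Fin (d + 1)) (n : ℕ) : ℚ :=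
  factorialFunctional (laguerreNeg n ^ (j : ℕ) * derivative (laguerreNeg n) ^ (d - j))

theorem isPolyComb_moment_zero {d i k : ℕ} (h : i + k = d) :
    IsPolyComb (laguerreMoment d) fun n =>
      factorialFunctional (laguerreNeg n ^ i * derivative (laguerreNeg n) ^ k) := by
  subst h
  convert IsPolyComb.basis (s := laguerreMoment (i + k)) ⟨i, by omega⟩ using 2 with n
  simp only [laguerreMoment, Nat.add_sub_cancel_left]

theorem moment_reduction (n m i k : ℕ) :
    (k + 1 : ℚ) * factorialFunctional
        (X ^ (m + 1) * (laguerreNeg n ^ i * derivative (laguerreNeg n) ^ k)) =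
      i * factorialFunctional
        (X ^ (m + 1) * (laguerreNeg n ^ (i - 1) * derivative (laguerreNeg n) ^ (k + 1))) +
      ((m + 1) * factorialFunctional
        (X ^ m * (laguerreNeg n ^ i * derivative (laguerreNeg n) ^ k)) +
      k * (n * factorialFunctional
        (X ^ m * (laguerreNeg n ^ (i + 1) * derivative (laguerreNeg n) ^ (k - 1))))) := by
  have hode := laguerreNeg_ode n
  have hpart := factorialFunctional_derivative
    (X ^ (m + 1) * (laguerreNeg n ^ i * derivative (laguerreNeg n) ^ k))
  have h0 : (X ^ (m + 1) * (laguerreNeg n ^ i * derivative (laguerreNeg n) ^ k)).eval 0 = 0 := by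
    simp
  have hder : derivative (X ^ (m + 1) * (laguerreNeg n ^ i * derivative (laguerreNeg n) ^ k)) +
      C (k : ℚ) * (X ^ (m + 1) * (laguerreNeg n ^ i * derivative (laguerreNeg n) ^ k)) =
      C (i : ℚ) * (X ^ (m + 1) *
        (laguerreNeg n ^ (i - 1) * derivative (laguerreNeg n) ^ (k + 1))) +
      (C (m + 1 : ℚ) * (X ^ m * (laguerreNeg n ^ i * derivative (laguerreNeg n) ^ k)) +
      C (k : ℚ) * (C (n : ℚ) *
        (X ^ m * (laguerreNeg n ^ (i + 1) * derivative (laguerreNeg n) ^ (k - 1))))) := by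
    rw [derivative_mul, derivative_mul, derivative_X_pow, derivative_pow, derivative_pow]
    cases k with
    | zero => simp; ring
    | succ k =>
      simp only [Nat.cast_add, Nat.cast_one, Nat.add_sub_cancel, C_add, C_1] at *
      linear_combination (C (k : ℚ) + 1) * X ^ m * laguerreNeg n ^ i *
        derivative (laguerreNeg n) ^ k * hode
  have := congrArg factorialFunctional hder
  simp only [map_add factorialFunctional, factorialFunctional_C_mul] at this
  rw [h0] at hpart
  linear_combination this - hpart

theorem isPolyComb_moment {d : ℕ} (m : ℕ) {i k : ℕ} (h : i + k = d) :
    IsPolyComb (laguerreMoment d) fun n =>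
      factorialFunctional (X ^ m * (laguerreNeg n ^ i * derivative (laguerreNeg n) ^ k)) := by
  induction m generalizing i k with
  | zero => simpa using isPolyComb_moment_zero h
  | succ m ihm =>
    induction i generalizing k with
    | zero =>
      have hk : (k + 1 : ℚ) ≠ 0 := by positivity
      have hlow : IsPolyComb (laguerreMoment d) fun n => k * (n * factorialFunctional
          (X ^ m * (laguerreNeg n ^ (0 + 1) * derivative (laguerreNeg n) ^ (k - 1)))) := by
        cases k with
        | zero => simpa using IsPolyComb.zero
        | succ k => exact (ihm (by omega)).index_mul.const_mul _
      have := (((ihm h).const_mul (m + 1)).add hlow).const_mul (k + 1 : ℚ)⁻¹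
      convert this using 2 with n
      rw [eq_inv_mul_iff_mul_eq₀ hk, moment_reduction]
      simp
    | succ i ihi =>
      have hk : (k + 1 : ℚ) ≠ 0 := by positivity
      have hlow : IsPolyComb (laguerreMoment d) fun n => k * (n * factorialFunctional
          (X ^ m * (laguerreNeg n ^ (i + 1 + 1) * derivative (laguerreNeg n) ^ (k - 1)))) := by
        cases k with
        | zero => simpa using IsPolyComb.zero
        | succ k => exact (ihm (by omega)).index_mul.const_mul _
      have := (((ihi (k := k + 1) (by omega)).const_mul (i + 1 : ℕ)).add
        (((ihm h).const_mul (m + 1)).add hlow)).const_mul (k + 1 : ℚ)⁻¹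
      convert this using 2 with n
      rw [eq_inv_mul_iff_mul_eq₀ hk, moment_reduction]
      simp

theorem isPolyComb_mixed_moment {d : ℕ} (j k : ℕ) {m i l : ℕ} (h : i + l + j + k = d) :
    IsPolyComb (laguerreMoment d) fun n =>
      factorialFunctional (X ^ m * (laguerreNeg n ^ i * derivative (laguerreNeg n) ^ l) *
        ((C (n : ℚ) + X) * laguerreNeg n + X * derivative (laguerreNeg n)) ^ j *
        (laguerreNeg n + derivative (laguerreNeg n)) ^ k) := by
  induction k generalizing m i l with
  | succ k ih =>
    convert (ih (m := m) (i := i + 1) (l := l) (by omega)).add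
      (ih (m := m) (i := i) (l := l + 1) (by omega)) using 2 with n
    rw [← map_add]
    congr 1
    ring
  | zero =>
    induction j generalizing m i l with
    | zero => simpa using isPolyComb_moment m (by omega)
    | succ j ih =>
      convert (ih (m := m) (i := i + 1) (l := l) (by omega)).index_mul.add
        ((ih (m := m + 1) (i := i + 1) (l := l) (by omega)).add
          (ih (m := m + 1) (i := i) (l := l + 1) (by omega))) using 2 with n
      rw [← factorialFunctional_C_mul, ← map_add, ← map_add]
      congr 1
      ring

theorem isPolyComb_laguerreMoment_succ {d : ℕ} (j : Fin (d + 1)) :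
    IsPolyComb (laguerreMoment d) fun n =>
      ((X + 1) ^ d : ℚ[X]).eval (n : ℚ) * laguerreMoment d j (n + 1) := by
  obtain ⟨j, hj⟩ := j
  obtain ⟨k, rfl⟩ := Nat.exists_eq_add_of_le (Nat.lt_succ_iff.mp hj)
  convert (isPolyComb_mixed_moment j k (m := 0) (i := 0) (l := 0)
    (d := j + k) (by omega)).poly_mul ((X + 1) ^ k) using 2 with n
  simp only [laguerreMoment, ← C_mul_laguerreNeg_succ, derivative_laguerreNeg_succ, mul_pow,
    Nat.add_sub_cancel_left, pow_zero, one_mul, ← C_pow, mul_assoc, factorialFunctional_C_mul,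
    eval_pow, eval_add, eval_X, eval_one]
  ring

theorem exists_isPolyComb_laguerreMoment_add {d : ℕ} (j : Fin (d + 1)) (b : ℕ) :
    ∃ D : ℚ[X], (∀ n : ℕ, D.eval (n : ℚ) ≠ 0) ∧
      IsPolyComb (laguerreMoment d) fun n => D.eval (n : ℚ) * laguerreMoment d j (n + b) := by
  induction b with
  | zero => exact ⟨1, by simp, by simpa using IsPolyComb.basis j⟩
  | succ b ih =>
    obtain ⟨D, hD, h⟩ := ih
    refine ⟨(X + 1) ^ d * D.comp (X + 1), fun n => ?_, ?_⟩
    · have hn : (n + 1 : ℚ) ≠ 0 := by positivity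
      have := hD (n + 1)
      push_cast at this
      simp [hn, this]
    · convert h.shift isPolyComb_laguerreMoment_succ using 2 with n
      simp only [eval_mul, eval_comp, eval_add, eval_X, eval_one, Nat.cast_add, Nat.cast_one,
        mul_assoc, add_assoc, add_comm 1 b]

theorem rookWalkCount_diagonal (d n : ℕ) :
    (rookWalkCount d (fun _ => n) : ℚ) = laguerreMoment d (Fin.last d) n := by
  simp [rookWalkCount_eq_factorialFunctional, laguerreMoment]

/-- For every `d ≥ 1`, the diagonal sequence of `d`-dimensional rook walk
numbers satisfies a nontrivial linear recurrence with polynomial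
coefficients: there are polynomials `p₀,…,p_r ∈ ℚ[x]`, not all zero, with
`∑_{i=0}^{r} pᵢ(n)·a_d(n+i,…,n+i) = 0` for all `n ≥ 0`. -/
theorem rook_diag_holonomic (d : ℕ) (hd : 1 ≤ d) :
    ∃ (r : ℕ) (p : ℕ → Polynomial ℚ),
      (∃ i ≤ r, p i ≠ 0) ∧
      ∀ n : ℕ,
        ∑ i ∈ Finset.range (r + 1),
          (p i).eval (n : ℚ) * (rookWalkCount d (fun _ => n + i) : ℚ) = 0 := by
  refine ⟨d + 1, ?_⟩
  simp only [rookWalkCount_diagonal]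
  refine IsPolyComb.exists_recurrence (s := laguerreMoment d) fun b => ?_
  obtain ⟨D, hD, h⟩ := exists_isPolyComb_laguerreMoment_add (Fin.last d) b
  exact ⟨D, fun h0 => hD 0 (by simp [h0]), h⟩
end
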